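/- arXiv:2503.16830 — 3 statements merged into one kernel-verified Lean document; each statement's English description precedes it below -/
import Mathlib

section
/- Let K be a field of characteristic p > 0, let a ∈ W_n(K), and let x = (x_0, …, x_{n-1}) ∈ W_n(K^sep) satisfy F(x) = x ⊕ a. For 1 ≤ i ≤ n-1 set K_i = K(x_0, …, x_{i-1}). Then the restriction of χ_a^K to G_{K_i} equals χ_b^{K_i}, where b = λ_i(μ_i(x) ⊕ a) ∈ W_n(K_i). -/
noncomputable section

open scoped Classical

/-- A separable closure `K^sep` of `K`. -/
abbrev SepCl (K : Type*) [Field K] : Type _ :=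
  separableClosure K (AlgebraicClosure K)

/-- The Frobenius `F` on truncated Witt vectors, induced by the `p`-th power map
on components. -/
def wittF {p n : ℕ} {R : Type*} [CommRing R] (x : TruncatedWittVector p n R) :
    TruncatedWittVector p n R :=
  TruncatedWittVector.mk p fun i => x.coeff i ^ p

/-- Componentwise application of a map (the inclusion `W_n(K) → W_n(K^sep)` and the
Galois action on Witt vectors are componentwise). -/
def wittMap {p n : ℕ} {R S : Type*} (f : R → S) (x : TruncatedWittVector p n R) :
    TruncatedWittVector p n S :=
  TruncatedWittVector.mk p fun i => f (x.coeff i)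

/-- `μ_i(a) = (a_0, …, a_{i-1}, 0, …, 0)`. -/
def wittMu {p n : ℕ} {R : Type*} [CommRing R] (i : ℕ) (x : TruncatedWittVector p n R) :
    TruncatedWittVector p n R :=
  TruncatedWittVector.mk p fun j => if (j : ℕ) < i then x.coeff j else 0

/-- `λ_i(a) = (0, …, 0, a_i, …, a_{n-1})`. -/
def wittLam {p n : ℕ} {R : Type*} [CommRing R] (i : ℕ) (x : TruncatedWittVector p n R) :
    TruncatedWittVector p n R :=
  TruncatedWittVector.mk p fun j => if (j : ℕ) < i then 0 else x.coeff j

section Helpers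

variable {p n : ℕ} [Fact p.Prime] {R S : Type*} [CommRing R] [CommRing S]

lemma wittMap_truncate (f : R →+* S) (X : WittVector p R) :
    wittMap f (WittVector.truncate n X) = WittVector.truncate n (WittVector.map f X) := by
  apply TruncatedWittVector.ext
  intro j
  simp [wittMap]

lemma wittMap_add' (f : R →+* S) (x y : TruncatedWittVector p n R) :
    wittMap f (x + y) = wittMap f x + wittMap f y := by
  obtain ⟨X, rfl⟩ := WittVector.truncate_surjective p n R x
  obtain ⟨Y, rfl⟩ := WittVector.truncate_surjective p n R y
  rw [← map_add, wittMap_truncate, wittMap_truncate, wittMap_truncate, map_add, map_add]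

lemma wittMap_sub' (f : R →+* S) (x y : TruncatedWittVector p n R) :
    wittMap f (x - y) = wittMap f x - wittMap f y := by
  rw [eq_sub_iff_add_eq, ← wittMap_add', sub_add_cancel]

lemma wittMu_truncate (i : ℕ) (X : WittVector p R) :
    wittMu i (WittVector.truncate n X) = WittVector.truncate n (WittVector.init i X) := by
  apply TruncatedWittVector.ext
  intro j
  simp [wittMu, WittVector.init, WittVector.select, WittVector.coeff_mk]

lemma wittLam_truncate (i : ℕ) (X : WittVector p R) :
    wittLam i (WittVector.truncate n X) = WittVector.truncate n (WittVector.tail i X) := by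
  apply TruncatedWittVector.ext
  intro j
  by_cases h : (j : ℕ) < i <;>
  simp [wittLam, WittVector.tail, WittVector.select, WittVector.coeff_mk, h]

lemma wittMu_add_wittLam (i : ℕ) (x : TruncatedWittVector p n R) :
    wittMu i x + wittLam i x = x := by
  obtain ⟨X, rfl⟩ := WittVector.truncate_surjective p n R x
  rw [wittMu_truncate, wittLam_truncate, ← map_add, WittVector.init_add_tail]

lemma wittMu_wittMu_add (i : ℕ) (x y : TruncatedWittVector p n R) :
    wittMu i (wittMu i x + y) = wittMu i (x + y) := by
  obtain ⟨X, rfl⟩ := WittVector.truncate_surjective p n R x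
  obtain ⟨Y, rfl⟩ := WittVector.truncate_surjective p n R y
  rw [wittMu_truncate, ← map_add, ← map_add, wittMu_truncate, wittMu_truncate,
    WittVector.init_add, WittVector.init_init, ← WittVector.init_add]

lemma wittF_eq [CharP R p] (x : TruncatedWittVector p n R) :
    wittF x = wittMap (frobenius R p) x := rfl

lemma wittF_wittMu (i : ℕ) (x : TruncatedWittVector p n R) :
    wittF (wittMu i x) = wittMu i (wittF x) := by
  apply TruncatedWittVector.ext
  intro j
  by_cases h : (j : ℕ) < i <;>
  simp [wittMu, wittF, h, (Fact.out : p.Prime).ne_zero]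

end Helpers

/-- Proposition 2 of the paper.  Let `K` be a field of characteristic
`p > 0`, `a ∈ W_n(K)`, and let `x = (x_0, …, x_{n-1}) ∈ W_n(K^sep)` satisfy
`F(x) = x ⊕ a`.  For `1 ≤ i ≤ n-1` set `K_i = K(x_0, …, x_{i-1})`.  Then
`b = λ_i(μ_i(x) ⊕ a)` lies in `W_n(K_i)`, and the restriction of `χ_a^K` to `G_{K_i}`
equals `χ_b^{K_i}`: for every `σ ∈ G_{K_i}` and every solution `y` of `F(y) = y ⊕ b`,
one has `σ(x) ⊖ x = σ(y) ⊖ y`. -/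
theorem stmt_1 {p : ℕ} [Fact p.Prime] {K : Type} [Field K] [CharP K p]
    (n : ℕ) (a : TruncatedWittVector p n K)
    (x : TruncatedWittVector p n (SepCl K))
    (hx : wittF x = x + wittMap (algebraMap K (SepCl K)) a)
    (i : ℕ) (hi1 : 1 ≤ i) (hi2 : i ≤ n - 1) :
    (∀ j : Fin n,
      (wittLam i (wittMu i x + wittMap (algebraMap K (SepCl K)) a)).coeff j ∈
        IntermediateField.adjoin K {α : SepCl K | ∃ j : Fin n, (j : ℕ) < i ∧ x.coeff j = α}) ∧
    (∀ σ : SepCl K ≃ₐ[K] SepCl K,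
      σ ∈ (IntermediateField.adjoin K
          {α : SepCl K | ∃ j : Fin n, (j : ℕ) < i ∧ x.coeff j = α}).fixingSubgroup →
      ∀ y : TruncatedWittVector p n (SepCl K),
        wittF y = y + wittLam i (wittMu i x + wittMap (algebraMap K (SepCl K)) a) →
        wittMap σ x - x = wittMap σ y - y) := by
  have : CharP (SepCl K) p :=
    charP_of_injective_algebraMap (algebraMap K (SepCl K)).injective p
  set A := wittMap (algebraMap K (SepCl K)) a with hA
  set L := IntermediateField.adjoin K
    {α : SepCl K | ∃ j : Fin n, (j : ℕ) < i ∧ x.coeff j = α} with hL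
  have hxL : ∀ j : Fin n, (j : ℕ) < i → x.coeff j ∈ L := fun j hj =>
    IntermediateField.subset_adjoin K _ ⟨j, hj, rfl⟩
  refine ⟨?_, ?_⟩
  · intro j
    have hmu : ∀ j : Fin n, (wittMu i x).coeff j ∈ L := by
      intro j
      by_cases h : (j : ℕ) < i
      · simpa [wittMu, h] using hxL j h
      · simp [wittMu, h]
    let u : TruncatedWittVector p n L := TruncatedWittVector.mk p fun j => ⟨_, hmu j⟩
    have hu : wittMap (algebraMap L (SepCl K)) u = wittMu i x := rfl
    have ha : wittMap (algebraMap L (SepCl K)) (wittMap (algebraMap K L) a) = A := rfl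
    rw [← hu, ← ha, ← wittMap_add']
    by_cases h : (j : ℕ) < i
    · simp [wittLam, h]
    · simp only [wittLam, h, TruncatedWittVector.coeff_mk, if_false, wittMap]
      exact SetLike.coe_mem _
  · intro σ hσ y hy
    have hfix : ∀ z : TruncatedWittVector p n (SepCl K), wittF z = z →
        wittMap (σ : SepCl K →+* SepCl K) z = z := by
      intro z hz
      apply TruncatedWittVector.ext
      intro j
      have h1 : z.coeff j ^ p = z.coeff j := by
        have := congrArg (TruncatedWittVector.coeff j) hz
        simpa [wittF] using this
      have h2 := (Subfield.mem_bot_iff_pow_eq_self (SepCl K) p).2 h1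
      have h3 : (⊥ : Subfield (SepCl K)) ≤
        RingHom.eqLocusField (σ : SepCl K →+* SepCl K) (RingHom.id _) := bot_le
      exact h3 h2
    have hmu : wittMap (σ : SepCl K →+* SepCl K) (wittMu i x) = wittMu i x := by
      apply TruncatedWittVector.ext
      intro j
      by_cases h : (j : ℕ) < i
      · simpa [wittMu, wittMap, h] using
          (IntermediateField.mem_fixingSubgroup_iff _ _).1 hσ _ (hxL j h)
      · simp [wittMu, wittMap, h]
    have hb := wittMu_add_wittLam i (wittMu i x + A)
    rw [wittMu_wittMu_add, ← hx, ← wittF_wittMu] at hb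
    have hxs := wittMu_add_wittLam i x
    set m := wittMu i x
    set l := wittLam i x
    have hFx : wittF x = wittF m + wittF l := by
      rw [← hxs, wittF_eq, wittMap_add']; rfl
    have hz := hfix (y - l) (by
      have : wittF (y - l) = wittF y - wittF l := by
        rw [wittF_eq, wittMap_sub']; rfl
      rw [this, hy]
      have e1 : wittF l = wittF x - wittF m := by rw [hFx]; abel
      have e2 : wittLam i (m + A) = m + A - wittF m := by
        rw [eq_sub_iff_add_eq, add_comm, hb]
      rw [e1, e2, hx]
      nth_rewrite 1 [← hxs]
      abel)
    change wittMap (σ : SepCl K →+* SepCl K) x - x = wittMap (σ : SepCl K →+* SepCl K) y - y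
    rw [wittMap_sub'] at hz
    have hsx : wittMap (σ : SepCl K →+* SepCl K) x =
        m + wittMap (σ : SepCl K →+* SepCl K) l := by
      rw [← hmu, ← wittMap_add', hxs]
    rw [hsx, sub_eq_sub_iff_add_eq_add]
    rw [sub_eq_iff_eq_add] at hz
    rw [hz]
    nth_rewrite 1 [← hxs]
    abel
end
end

section
/- Let K be a field of characteristic p > 0, let a ∈ W_n(K), and let x = (x_0, …, x_{n-1}) ∈ W_n(K^sep) satisfy F(x) = x ⊕ a. For 1 ≤ i ≤ n-1 set K_i = K(x_0, …, x_{i-1}) and write λ_i(μ_i(x) ⊕ a) = (0, …, 0, d_0, …, d_{n-i-1}) ∈ W_n(K_i) (with i leading zeros). Set d = (d_0, …, d_{n-i-1}) ∈ W_{n-i}(K_i). Then the restriction of χ_a^K to G_{K_i} equals η_{n-i,n} ∘ χ_d^{K_i}, where η_{j,n} : Z/p^jZ → Z/p^nZ sends r + p^jZ to p^{n-j}r + p^nZ. -/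
noncomputable section

open scoped Classical

/-- The canonical embedding `ℤ/p^nℤ ≅ W_n(𝔽_p) → W_n(R)` (for `R` of characteristic `p`),
sending `s + p^nℤ` to `s · 1`. -/
def wittInt (p n : ℕ) (R : Type*) [CommRing R] [Fact p.Prime] (s : ZMod (p ^ n)) :
    TruncatedWittVector p n R :=
  (s.val : TruncatedWittVector p n R)

/-- `η_{j,n} : ℤ/p^jℤ → ℤ/p^nℤ`, `r + p^jℤ ↦ p^{n-j} r + p^nℤ`. -/
def etaMap (p j n : ℕ) (r : ZMod (p ^ j)) : ZMod (p ^ n) :=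
  (p : ZMod (p ^ n)) ^ (n - j) * (r.val : ZMod (p ^ n))


section Helpers

open WittVector

theorem trunc_eq_iff {p : ℕ} [Fact p.Prime] {L : Type*} [CommRing L] {n : ℕ}
    {X Y : WittVector p L} :
    WittVector.truncate n X = WittVector.truncate n Y ↔ ∀ j < n, X.coeff j = Y.coeff j := by
  constructor
  · intro h j hj
    have := congrArg (TruncatedWittVector.coeff ⟨j, hj⟩) h
    simpa only [WittVector.coeff_truncate] using this
  · intro h
    ext j
    simpa only [WittVector.coeff_truncate] using h j j.2

theorem trunc_V_iff {p : ℕ} [Fact p.Prime] {L : Type*} [CommRing L] {n i : ℕ}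
    {X Y : WittVector p L} :
    WittVector.truncate n (verschiebung^[i] X) = WittVector.truncate n (verschiebung^[i] Y) ↔
      WittVector.truncate (n - i) X = WittVector.truncate (n - i) Y := by
  rw [trunc_eq_iff, trunc_eq_iff]
  constructor
  · intro h j hj
    have := h (j + i) (by omega)
    simpa only [iterate_verschiebung_coeff] using this
  · intro h j hj
    by_cases hji : j < i
    · rw [iterate_verschiebung_coeff_eq_zero _ hji, iterate_verschiebung_coeff_eq_zero _ hji]
    · obtain ⟨k, rfl⟩ : ∃ k, j = k + i := ⟨j - i, by omega⟩
      rw [iterate_verschiebung_coeff, iterate_verschiebung_coeff]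
      exact h k (by omega)

theorem coeff_init_lt {p : ℕ} {L : Type*} [CommRing L] {i j : ℕ}
    (X : WittVector p L) (h : j < i) : (init i X).coeff j = X.coeff j := by
  simp [init, select, h]

theorem coeff_init_ge {p : ℕ} {L : Type*} [CommRing L] {i j : ℕ}
    (X : WittVector p L) (h : ¬ j < i) : (init i X).coeff j = 0 := by
  simp [init, select, h]

theorem init_add_V_shift {p : ℕ} [Fact p.Prime] {L : Type*} [CommRing L] (i : ℕ)
    (X : WittVector p L) : X = init i X + verschiebung^[i] (X.shift i) := by
  have h : verschiebung^[i] (X.shift i) = tail i X := by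
    rw [eq_iterate_verschiebung (x := tail i X) (n := i)]
    · congr 1
      ext k
      simp [shift_coeff, tail, select]
    · intro j hj
      simp [tail, select, hj]
  rw [h, init_add_tail]

theorem map_V_iter {p : ℕ} [Fact p.Prime] {L : Type*} [CommRing L] (f : L →+* L) (i : ℕ)
    (X : WittVector p L) :
    WittVector.map f (verschiebung^[i] X) = verschiebung^[i] (WittVector.map f X) :=
  (Function.Semiconj.iterate_right (f := WittVector.map f)
    (fun y => map_verschiebung f y) i) X

theorem core {p : ℕ} [Fact p.Prime] {L : Type*} [Field L] [CharP L p] (σ : L →+* L)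
    (n i : ℕ) (hi : i ≤ n) (X A Z D : WittVector p L) (s : ℕ)
    (hx : WittVector.truncate n (frobenius X) = WittVector.truncate n (X + A))
    (hd : WittVector.truncate (n - i) D =
      WittVector.truncate (n - i) ((init i X + A).shift i))
    (hσ : ∀ j < i, σ (X.coeff j) = X.coeff j)
    (hz : WittVector.truncate (n - i) (frobenius Z) = WittVector.truncate (n - i) (Z + D))
    (hs : WittVector.truncate (n - i) (WittVector.map σ Z - Z) =
      WittVector.truncate (n - i) (s : WittVector p L)) :
    WittVector.truncate n (WittVector.map σ X - X) =
      WittVector.truncate n ((s : WittVector p L) * (p : WittVector p L) ^ i) := by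
  have hp : p ≠ 0 := (Fact.out : p.Prime).ne_zero
  set W := X.shift i with hW
  set M := init i X with hM
  set B := M + A with hB
  have hX : X = M + verschiebung^[i] W := init_add_V_shift i X
  have hB' : B = init i B + verschiebung^[i] (B.shift i) := init_add_V_shift i B
  have hFM : init i B = frobenius M := by
    ext j
    rw [coeff_frobenius_charP]
    by_cases hj : j < i
    · rw [coeff_init_lt _ hj, hM, coeff_init_lt _ hj, ← coeff_frobenius_charP]
      have h1 := trunc_eq_iff.1 hx j (by omega)
      rw [h1]
      have h2 : WittVector.truncate i B = WittVector.truncate i (X + A) := by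
        rw [hB, map_add, map_add]
        congr 1
        exact trunc_eq_iff.2 fun k hk => coeff_init_lt _ hk
      exact trunc_eq_iff.1 h2 j hj
    · rw [coeff_init_ge _ hj, hM, coeff_init_ge _ hj, zero_pow hp]
  have hFV : frobenius (verschiebung^[i] W) = verschiebung^[i] (frobenius W) :=
    ((Function.Commute.iterate_left verschiebung_frobenius_comm i) W).symm
  have hFW : WittVector.truncate (n - i) (frobenius W) =
      WittVector.truncate (n - i) (W + D) := by
    rw [map_add, hd, ← map_add, ← trunc_V_iff]
    have e1 : frobenius X = frobenius M + verschiebung^[i] (frobenius W) := by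
      rw [← hFV, ← map_add, ← hX]
    have e2 : X + A = frobenius M + verschiebung^[i] (W + B.shift i) := by
      rw [iterate_map_add, ← hFM]
      calc X + A = verschiebung^[i] W + B := by rw [hB]; nth_rewrite 1 [hX]; ring
        _ = _ := by nth_rewrite 1 [hB']; ring
    rw [e1, e2, map_add, map_add] at hx
    exact add_left_cancel hx
  have hU : WittVector.truncate (n - i) (WittVector.map σ (W - Z)) =
      WittVector.truncate (n - i) (W - Z) := by
    have h1 : WittVector.truncate (n - i) (frobenius (W - Z)) =
        WittVector.truncate (n - i) (W - Z) := by
      rw [map_sub, map_sub, hFW, hz, map_add, map_add, map_sub]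
      ring
    refine trunc_eq_iff.2 fun j hj => ?_
    have h2 := trunc_eq_iff.1 h1 j hj
    rw [coeff_frobenius_charP, ← Subfield.mem_bot_iff_pow_eq_self] at h2
    rw [WittVector.map_coeff]
    have h3 : (⊥ : Subfield L) ≤ RingHom.eqLocusField σ (RingHom.id L) := bot_le
    exact h3 h2
  have hsW : WittVector.truncate (n - i) (WittVector.map σ W - W) =
      WittVector.truncate (n - i) (s : WittVector p L) := by
    rw [← hs]
    simp only [map_sub] at hU ⊢
    linear_combination hU
  have hMσ : WittVector.map σ M = M := by
    ext j
    rw [WittVector.map_coeff]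
    by_cases hj : j < i
    · rw [hM, coeff_init_lt _ hj, hσ j hj]
    · rw [hM, coeff_init_ge _ hj, map_zero]
  have e : WittVector.map σ X - X = verschiebung^[i] (WittVector.map σ W - W) := by
    rw [iterate_map_sub, ← map_V_iter]
    nth_rewrite 1 [hX]
    rw [map_add, hMσ]
    linear_combination -hX
  rw [e, ← iterate_verschiebung_iterate_frobenius, trunc_V_iff, hsW]
  congr 1
  have : ∀ k : ℕ, frobenius^[k] (s : WittVector p L) = s := by
    intro k
    exact Function.iterate_fixed (map_natCast _ _) k
  rw [this]

theorem trunc_natCast_mod {p : ℕ} [Fact p.Prime] {L : Type*} [CommRing L] [CharP L p]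
    (n m : ℕ) : ((m % p ^ n : ℕ) : TruncatedWittVector p n L) = m := by
  have h0 : ((p : TruncatedWittVector p n L)) ^ n = 0 := by
    have h : WittVector.truncate n ((p : WittVector p L) ^ n) =
        WittVector.truncate n (0 : WittVector p L) := by
      have := iterate_verschiebung_iterate_frobenius (1 : WittVector p L) n
      rw [one_mul] at this
      rw [← this]
      refine trunc_eq_iff.2 fun j hj => ?_
      rw [iterate_verschiebung_coeff_eq_zero _ hj, WittVector.zero_coeff]
    simpa using h
  conv_rhs => rw [← Nat.mod_add_div m (p ^ n)]
  push_cast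
  rw [h0, zero_mul, add_zero]

theorem trunc_out {p : ℕ} [Fact p.Prime] {L : Type*} [CommRing L] {n : ℕ}
    (x : TruncatedWittVector p n L) : WittVector.truncate n x.out = x :=
  TruncatedWittVector.truncateFun_out x

theorem wittF_eq_s2 {p : ℕ} [Fact p.Prime] {L : Type*} [CommRing L] [CharP L p] {n : ℕ}
    (x : TruncatedWittVector p n L) :
    wittF x = WittVector.truncate n (frobenius x.out) := by
  ext j
  rw [WittVector.coeff_truncate, coeff_frobenius_charP, TruncatedWittVector.coeff_out, wittF,
    TruncatedWittVector.coeff_mk]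

theorem wittMap_eq {p : ℕ} [Fact p.Prime] {L : Type*} [CommRing L] {n : ℕ} (σ : L →+* L)
    (x : TruncatedWittVector p n L) :
    wittMap σ x = WittVector.truncate n (WittVector.map σ x.out) := by
  ext j
  rw [WittVector.coeff_truncate, WittVector.map_coeff, TruncatedWittVector.coeff_out, wittMap,
    TruncatedWittVector.coeff_mk]

theorem wittMu_eq {p : ℕ} [Fact p.Prime] {L : Type*} [CommRing L] {n : ℕ} (i : ℕ)
    (x : TruncatedWittVector p n L) :
    wittMu i x = WittVector.truncate n (init i x.out) := by
  ext j
  rw [WittVector.coeff_truncate, wittMu, TruncatedWittVector.coeff_mk]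
  split_ifs with h
  · rw [coeff_init_lt _ h, TruncatedWittVector.coeff_out]
  · rw [coeff_init_ge _ h]

end Helpers

/-- Corollary 3 of the paper.  Let `K` be a field of characteristic
`p > 0`, `a ∈ W_n(K)`, and `x = (x_0, …, x_{n-1}) ∈ W_n(K^sep)` with `F(x) = x ⊕ a`.
For `1 ≤ i ≤ n-1` set `K_i = K(x_0, …, x_{i-1})` and write
`λ_i(μ_i(x) ⊕ a) = (0, …, 0, d_0, …, d_{n-i-1})`, `d = (d_0, …, d_{n-i-1}) ∈ W_{n-i}(K_i)`.
Then `χ_a^K` restricted to `G_{K_i}` equals `η_{n-i,n} ∘ χ_d^{K_i}`: for `σ ∈ G_{K_i}`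
and any solution `z` of `F(z) = z ⊕ d`, if `σ(z) ⊖ z` corresponds to
`s ∈ ℤ/p^{n-i}ℤ` then `σ(x) ⊖ x` corresponds to `η_{n-i,n}(s) ∈ ℤ/p^nℤ`. -/
theorem stmt_2 {p : ℕ} [Fact p.Prime] {K : Type} [Field K] [CharP K p]
    (n : ℕ) (a : TruncatedWittVector p n K)
    (x : TruncatedWittVector p n (SepCl K))
    (hx : wittF x = x + wittMap (algebraMap K (SepCl K)) a)
    (i : ℕ) (hi1 : 1 ≤ i) (hi2 : i ≤ n - 1)
    (d : TruncatedWittVector p (n - i) (SepCl K))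
    (hd : ∀ j : Fin (n - i),
      d.coeff j =
        (wittLam i (wittMu i x + wittMap (algebraMap K (SepCl K)) a)).coeff
          ⟨i + (j : ℕ), by have := j.2; omega⟩) :
    ∀ σ : SepCl K ≃ₐ[K] SepCl K,
      σ ∈ (IntermediateField.adjoin K
          {α : SepCl K | ∃ j : Fin n, (j : ℕ) < i ∧ x.coeff j = α}).fixingSubgroup →
      ∀ z : TruncatedWittVector p (n - i) (SepCl K),
        wittF z = z + d →
        ∀ s : ZMod (p ^ (n - i)),
          wittMap σ z - z = wittInt p (n - i) (SepCl K) s →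
          wittMap σ x - x = wittInt p n (SepCl K) (etaMap p (n - i) n s) := by
  intro σ hσ z hz s hs
  have : CharP (SepCl K) p := charP_of_injective_algebraMap' K p
  have hin : i ≤ n := by omega
  set b := wittMap (algebraMap K (SepCl K)) a with hb
  have hσ' : ∀ j < i, σ (x.out.coeff j) = x.out.coeff j := by
    intro j hj
    have hjn : j < n := by omega
    have h1 : x.out.coeff j = x.coeff ⟨j, hjn⟩ :=
      TruncatedWittVector.coeff_out x ⟨j, hjn⟩
    rw [h1]
    exact (IntermediateField.mem_fixingSubgroup_iff _ _).1 hσ _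
      (IntermediateField.subset_adjoin K _ ⟨⟨j, hjn⟩, hj, rfl⟩)
  have hs' : wittMap ((σ : SepCl K ≃+* SepCl K) : SepCl K →+* SepCl K) z - z =
      ((s.val : ℕ) : TruncatedWittVector p (n - i) (SepCl K)) := hs
  have key := core ((σ : SepCl K ≃+* SepCl K) : SepCl K →+* SepCl K) n i hin x.out b.out z.out
    d.out s.val ?_ ?_ hσ' ?_ ?_
  · rw [map_sub, ← wittMap_eq, trunc_out] at key
    refine Eq.trans key ?_
    rw [wittInt, etaMap]
    have h1 : n - (n - i) = i := by omega
    have h2 : (p : ZMod (p ^ n)) ^ (n - (n - i)) * (s.val : ZMod (p ^ n)) =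
        ((s.val * p ^ i : ℕ) : ZMod (p ^ n)) := by
      rw [h1]; push_cast; ring
    rw [h2, ZMod.val_natCast, trunc_natCast_mod, Nat.cast_mul, Nat.cast_pow, map_mul, map_pow, map_natCast, map_natCast]
  · rw [← wittF_eq_s2, map_add, trunc_out, trunc_out, hx]
  · rw [trunc_out]
    ext j
    rw [hd j, WittVector.coeff_truncate, WittVector.shift_coeff, wittLam,
      TruncatedWittVector.coeff_mk, if_neg (by simp)]
    have h1 : wittMu i x + b = WittVector.truncate n (WittVector.init i x.out + b.out) := by
      rw [map_add, trunc_out, wittMu_eq]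
    rw [h1, WittVector.coeff_truncate]
  · rw [← wittF_eq_s2, map_add, trunc_out, trunc_out, hz]
  · rw [map_sub, ← wittMap_eq, trunc_out, hs', map_natCast]
end
end

section
/- Let K be a local field of characteristic p > 0 with perfect residue field and let a = (a_0, …, a_{n-1}) ∈ W_n(K) be a reduced Witt vector. For 0 ≤ i ≤ n-1 set m_i = -v_K(a_i), and assume m_0 > 0. Let x = (x_0, …, x_{n-1}) ∈ W_n(K^sep) satisfy F(x) = x ⊕ a and set K_n = K(x_0, …, x_{n-1}). Then K_n/K is a totally ramified (Z/p^nZ)-extension, and for each 1 ≤ i ≤ n its i-th upper ramification break is u_i = max{p^{i-1} m_0, p^{i-2} m_1, …, p m_{i-2}, m_{i-1}}. -/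
noncomputable section

open scoped Classical

/-- The normalized valuation on `k((t))`: `v(x)` is the order of vanishing of `x`,
with `v(0) = ∞`. -/
def lsVal {k : Type*} [Field k] (x : LaurentSeries k) : WithTop ℤ :=
  if x = 0 then ⊤ else (x.order : WithTop ℤ)

/-- The normalized valuation `v_K` on a local field `K` presented by an isomorphism
`ι : K ≃ k((t))`. -/
def lfVal {K k : Type*} [Field K] [Field k] (ι : K ≃+* LaurentSeries k) (x : K) :
    WithTop ℤ :=
  lsVal (ι x)

/-- `v : L → ℤ ∪ {∞}` is a normalized discrete valuation on the field `L`: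
`v x = ∞` iff `x = 0`, `v` is multiplicative, satisfies the ultrametric
inequality, and `v(L^×) = ℤ` (there is a uniformizer of valuation `1`). -/
def IsNormVal {L : Type*} [Field L] (v : L → WithTop ℤ) : Prop :=
  (∀ x, v x = ⊤ ↔ x = 0) ∧
  (∀ x y, v (x * y) = v x + v y) ∧
  (∀ x y, min (v x) (v y) ≤ v (x + y)) ∧
  (∃ π, v π = (1 : ℤ))

/-- The valuation `v` on `L` restricts on `K` to `e` times the normalized valuation
`vK` of `K`; thus `e = e_{L/K}` is the ramification index of `L/K`. -/
def ExtendsWithE {K L : Type*} [Field K] [Field L] [Algebra K L]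
    (vK : K → WithTop ℤ) (v : L → WithTop ℤ) (e : ℕ) : Prop :=
  ∀ (x : K) (z : ℤ), vK x = (z : WithTop ℤ) →
    v (algebraMap K L x) = (((e : ℤ) * z : ℤ) : WithTop ℤ)

/-- `σ` lies in the inertia subgroup `G_0` of `Gal(L/F)`: `σ` induces the identity
on the residue field. -/
def InInertia {F L : Type*} [Field F] [Field L] [Algebra F L]
    (v : L → WithTop ℤ) (σ : L ≃ₐ[F] L) : Prop :=
  ∀ x : L, 0 ≤ v x → (1 : ℤ) ≤ v (σ x - x)

/-- The ramification group `G_x = {σ ∈ G_0 : v_L(σ(π_L) - π_L) ≥ x + 1}` of `Gal(L/F)`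
in the lower numbering (for real `x`); since `v_L` is integer valued, the condition
`v_L(σ(π_L) - π_L) ≥ x + 1` is expressed via the ceiling `⌈x + 1⌉`. -/
def ramGrp (F : Type*) {L : Type*} [Field F] [Field L] [Algebra F L]
    (v : L → WithTop ℤ) (π : L) (x : ℝ) : Set (L ≃ₐ[F] L) :=
  {σ | InInertia v σ ∧ ((⌈x + 1⌉ : ℤ) : WithTop ℤ) ≤ v (σ π - π)}

/-- The Hasse–Herbrand function `φ_{L/F}(x) = ∫_0^x dt / (G_0 : G_t)`, where
`1/(G_0 : G_t) = |G_t|/|G_0|`. -/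
def hhPhi (F : Type*) {L : Type*} [Field F] [Field L] [Algebra F L]
    (v : L → WithTop ℤ) (π : L) (x : ℝ) : ℝ :=
  ∫ t in (0 : ℝ)..x, ((ramGrp F v π t).ncard : ℝ) / ((ramGrp F v π 0).ncard : ℝ)

/-- `ψ_{L/F}`, the inverse of the Hasse–Herbrand bijection `φ_{L/F} : ℝ_{≥0} → ℝ_{≥0}`. -/
def hhPsi (F : Type*) {L : Type*} [Field F] [Field L] [Algebra F L]
    (v : L → WithTop ℤ) (π : L) (u : ℝ) : ℝ :=
  Function.invFunOn (hhPhi F v π) (Set.Ici 0) u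

/-- The ramification group `G^u = G_{ψ_{L/F}(u)}` in the upper numbering. -/
def upperRamGrp (F : Type*) {L : Type*} [Field F] [Field L] [Algebra F L]
    (v : L → WithTop ℤ) (π : L) (u : ℝ) : Set (L ≃ₐ[F] L) :=
  ramGrp F v π (hhPsi F v π u)

/-- `b` is a lower ramification break of `L/F`: `b ≥ 0` and `G_{b+ε} ≠ G_b` for all
`ε > 0`. -/
def IsLowerBreak (F : Type*) {L : Type*} [Field F] [Field L] [Algebra F L]
    (v : L → WithTop ℤ) (π : L) (b : ℝ) : Prop :=
  0 ≤ b ∧ ∀ ε : ℝ, 0 < ε → ramGrp F v π (b + ε) ≠ ramGrp F v π b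

/-- `u` is an upper ramification break of `L/F`: `u ≥ 0` and `G^{u+ε} ≠ G^u` for all
`ε > 0`. -/
def IsUpperBreak (F : Type*) {L : Type*} [Field F] [Field L] [Algebra F L]
    (v : L → WithTop ℤ) (π : L) (u : ℝ) : Prop :=
  0 ≤ u ∧ ∀ ε : ℝ, 0 < ε → upperRamGrp F v π (u + ε) ≠ upperRamGrp F v π u

section wittUniv
open WittVector

theorem ww_ghost {p : ℕ} [Fact p.Prime] {R : Type*} [CommRing R] (x : WittVector p R) (j : ℕ) :
    ghostComponent j x = ∑ i ∈ Finset.range (j+1), (p:R)^i * x.coeff i ^ (p^(j-i)) := by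
  rw [ghostComponent_apply, aeval_wittPolynomial]

theorem ww_univ_aux {p : ℕ} [hp : Fact p.Prime] {R : Type*} [CommRing R]
    (hreg : ∀ f : R, (p:R) * f = 0 → f = 0) (Y S T : ℕ → R) (j : ℕ) :
    ∃ Q : Polynomial R,
      (WittVector.mk p (fun i => Polynomial.C (Y i) + Polynomial.X * Polynomial.C (S i))
        - WittVector.mk p (fun i => Polynomial.C (Y i))
        + WittVector.mk p (fun i => Polynomial.X * Polynomial.C (T i))).coeff j
      = Polynomial.X * Polynomial.C ((∑ i ∈ Finset.range (j+1), Y i ^ (p^(j-i) - 1) * S i) + T j)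
        + Polynomial.X^2 * Q := by
  set D := (WittVector.mk p (fun i => Polynomial.C (Y i) + Polynomial.X * Polynomial.C (S i))
        - WittVector.mk p (fun i => Polynomial.C (Y i))
        + WittVector.mk p (fun i => Polynomial.X * Polynomial.C (T i))) with hD
  clear_value D
  induction j using Nat.strong_induction_on with
  | _ j ih =>
  have hg := congrArg (ghostComponent j) hD
  rw [map_add, map_sub] at hg
  rw [ww_ghost, ww_ghost, ww_ghost, ww_ghost, Finset.sum_range_succ, Finset.sum_range_succ (n := j) (f := fun i => (p:Polynomial R)^i * (WittVector.mk p (fun i => Polynomial.X * Polynomial.C (T i))).coeff i ^ (p^(j-i)))] at hg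
  simp only [Nat.sub_self, pow_zero, pow_one, WittVector.coeff_mk] at hg
  have two_le : ∀ i ∈ Finset.range j, 2 ≤ p^(j-i) := by
    intro i hi
    have := Finset.mem_range.1 hi
    calc 2 ≤ p := hp.out.two_le
      _ = p^1 := (pow_one p).symm
      _ ≤ _ := Nat.pow_le_pow_right hp.out.pos (by omega)
  have h1 : (Polynomial.X : Polynomial R)^2 ∣ ∑ i ∈ Finset.range j, (p:Polynomial R)^i * D.coeff i ^ (p^(j-i)) := by
    refine Finset.dvd_sum fun i hi => Dvd.dvd.mul_left ?_ _
    obtain ⟨Q, hQ⟩ := ih i (Finset.mem_range.1 hi)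
    refine dvd_trans ?_ (pow_dvd_pow _ (two_le i hi))
    refine pow_dvd_pow_of_dvd ?_ 2
    rw [hQ, pow_two, mul_assoc]
    exact dvd_add (dvd_mul_right _ _) (dvd_mul_right _ _)
  have h2 : (Polynomial.X : Polynomial R)^2 ∣ ∑ i ∈ Finset.range j, (p:Polynomial R)^i * (Polynomial.X * Polynomial.C (T i)) ^ (p^(j-i)) := by
    refine Finset.dvd_sum fun i hi => Dvd.dvd.mul_left ?_ _
    refine dvd_trans ?_ (pow_dvd_pow _ (two_le i hi))
    exact pow_dvd_pow_of_dvd (dvd_mul_right _ _) 2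
  have h3 : (Polynomial.X : Polynomial R)^2 ∣ ∑ i ∈ Finset.range (j+1), (p:Polynomial R)^i * (Polynomial.C (Y i) + Polynomial.X * Polynomial.C (S i)) ^ (p^(j-i))
     - ∑ i ∈ Finset.range (j+1), (p:Polynomial R)^i * (Polynomial.C (Y i)) ^ (p^(j-i))
     - (p:Polynomial R)^j * (Polynomial.X * Polynomial.C (∑ i ∈ Finset.range (j+1), Y i ^ (p^(j-i) - 1) * S i)) := by
    rw [map_sum, Finset.mul_sum, Finset.mul_sum, ← Finset.sum_sub_distrib, ← Finset.sum_sub_distrib]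
    refine Finset.dvd_sum fun i hi => ?_
    obtain ⟨q, hq⟩ := Polynomial.powAddExpansion (Polynomial.C (Y i)) (Polynomial.X * Polynomial.C (S i)) (p^(j-i))
    rw [hq]
    have : (p:Polynomial R)^j = (p:Polynomial R)^i * ((p^(j-i) : ℕ) : Polynomial R) := by
      rw [Nat.cast_pow, ← pow_add]; congr 1; have := Finset.mem_range.1 hi; omega
    rw [this]
    refine ⟨(p:Polynomial R)^i * (q * Polynomial.C (S i)^2), ?_⟩
    simp only [map_mul, map_pow]
    ring
  have h4 : (Polynomial.X : Polynomial R)^2 ∣ (p:Polynomial R)^j * (D.coeff j - Polynomial.X * Polynomial.C ((∑ i ∈ Finset.range (j+1), Y i ^ (p^(j-i) - 1) * S i) + T j)) := by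
    obtain ⟨q1, h1⟩ := h1
    obtain ⟨q2, h2⟩ := h2
    obtain ⟨q3, h3⟩ := h3
    refine ⟨q3 + q2 - q1, ?_⟩
    rw [map_add]
    rw [h1, h2] at hg
    linear_combination hg + h3
  have h5 : ∀ (m : ℕ) (f : R), (p:R)^m * f = 0 → f = 0 := by
    intro m
    induction m with
    | zero => intro f hf; simpa using hf
    | succ m ihm => intro f hf; apply ihm; apply hreg; rw [← hf]; ring
  have h6 : (Polynomial.X : Polynomial R)^2 ∣ (D.coeff j - Polynomial.X * Polynomial.C ((∑ i ∈ Finset.range (j+1), Y i ^ (p^(j-i) - 1) * S i) + T j)) := by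
    rw [Polynomial.X_pow_dvd_iff] at h4 ⊢
    intro d hd
    have := h4 d hd
    apply h5 j
    rw [← this, ← Polynomial.coeff_C_mul]
    simp
  obtain ⟨Q, hQ⟩ := h6
  exact ⟨Q, by rw [← hQ]; ring⟩

theorem ww_map_mk {p : ℕ} [Fact p.Prime] {R S : Type*} [CommRing R] [CommRing S] (f : R →+* S)
    (x : ℕ → R) : WittVector.map f (WittVector.mk p x) = WittVector.mk p (fun i => f (x i)) := by
  ext i; simp [WittVector.map_coeff]

/-- First order expansion of `X - Y + Z` in Witt vectors. -/
theorem ww_univ {p : ℕ} [hp : Fact p.Prime] {A : Type*} [CommRing A]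
    (w : A) (Y S T : ℕ → A) (j : ℕ) :
    ∃ Q : A,
      (WittVector.mk p (fun i => Y i + w * S i)
        - WittVector.mk p Y + WittVector.mk p (fun i => w * T i)).coeff j
      = w * ((∑ i ∈ Finset.range (j+1), Y i ^ (p^(j-i) - 1) * S i) + T j) + w^2 * Q := by
  have hreg : ∀ f : MvPolynomial A ℤ, ((p:ℕ): MvPolynomial A ℤ) * f = 0 → f = 0 := by
    intro f hf
    rcases mul_eq_zero.1 hf with h | h
    · exact absurd (by exact_mod_cast h) hp.out.ne_zero
    · exact h
  obtain ⟨Q, hQ⟩ := ww_univ_aux (p := p) hreg (fun i => MvPolynomial.X (Y i))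
    (fun i => MvPolynomial.X (S i)) (fun i => MvPolynomial.X (T i)) j
  let c : MvPolynomial A ℤ →+* A := (MvPolynomial.aeval (fun a : A => a)).toRingHom
  let f : Polynomial (MvPolynomial A ℤ) →+* A := Polynomial.eval₂RingHom c w
  refine ⟨f Q, ?_⟩
  have := congrArg f hQ
  rw [← WittVector.map_coeff, map_add, map_sub, ww_map_mk, ww_map_mk, ww_map_mk] at this
  have e1 : ∀ a : A, f (Polynomial.C (MvPolynomial.X a)) = a := by intro a; simp [f, c]
  have e2 : f Polynomial.X = w := by simp [f]
  simp only [map_add, map_mul, map_pow, map_sum, e1, e2] at this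
  exact this

theorem ww_teich_aux₁ {p : ℕ} [hp : Fact p.Prime] {σ : Type*} (t : MvPolynomial σ ℚ) (x : WittVector p (MvPolynomial σ ℚ)) :
    teichmuller p t * x = WittVector.mk p (fun i => t ^ p^i * x.coeff i) := by
  apply (ghostMap.bijective_of_invertible p (MvPolynomial σ ℚ)).1
  rw [map_mul]
  ext1 n
  rw [Pi.mul_apply, ghostMap_apply, ghostMap_apply, ghostMap_apply, ghostComponent_teichmuller, ww_ghost, ww_ghost,
    Finset.mul_sum]
  refine Finset.sum_congr rfl fun i hi => ?_
  rw [WittVector.coeff_mk, mul_pow, ← pow_mul, ← pow_add]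
  have : i + (n - i) = n := by have := Finset.mem_range.1 hi; omega
  rw [this]; ring

theorem ww_teich {p : ℕ} [hp : Fact p.Prime] {A : Type*} [CommRing A] (t : A) (x : WittVector p A) :
    teichmuller p t * x = WittVector.mk p (fun i => t ^ p^i * x.coeff i) := by
  have h2 : ∀ (t : MvPolynomial A ℤ) (x : WittVector p (MvPolynomial A ℤ)),
    teichmuller p t * x = WittVector.mk p (fun i => t ^ p^i * x.coeff i) := by
    intro t x
    refine map_injective (MvPolynomial.map (Int.castRingHom ℚ))
      (MvPolynomial.map_injective _ Int.cast_injective) ?_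
    rw [map_mul, WittVector.map_teichmuller, ww_teich_aux₁, ww_map_mk]
    simp [WittVector.map_coeff]
  let c : MvPolynomial A ℤ →+* A := (MvPolynomial.aeval (fun a : A => a)).toRingHom
  have := congrArg (WittVector.map c) (h2 (MvPolynomial.X t) (WittVector.mk p fun i => MvPolynomial.X (x.coeff i)))
  rw [map_mul, WittVector.map_teichmuller, ww_map_mk, ww_map_mk] at this
  have e1 : ∀ a : A, c (MvPolynomial.X a) = a := by intro a; simp [c]
  simp only [map_mul, map_pow, e1, WittVector.coeff_mk] at this
  exact this

/-- Homogeneity. -/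
theorem ww_homog {p : ℕ} [hp : Fact p.Prime] {A : Type*} [CommRing A] (t : A) (X Y Z : ℕ → A) (j : ℕ) :
    (WittVector.mk p (fun i => t^p^i * X i) - WittVector.mk p (fun i => t^p^i * Y i)
      + WittVector.mk p (fun i => t^p^i * Z i)).coeff j
    = t^p^j * (WittVector.mk p X - WittVector.mk p Y + WittVector.mk p Z).coeff j := by
  have h : ∀ X : ℕ → A, WittVector.mk p (fun i => t^p^i * X i) = teichmuller p t * WittVector.mk p X := by
    intro X; rw [ww_teich]; simp only [WittVector.coeff_mk]
  rw [h, h, h, ← mul_sub, ← mul_add, ww_teich, WittVector.coeff_mk]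

end wittUniv


/-- `v` is a (not necessarily normalized) discrete valuation. -/
structure VV {L : Type*} [Field L] (v : L → WithTop ℤ) : Prop where
  top : ∀ x, v x = ⊤ ↔ x = 0
  mul : ∀ x y, v (x * y) = v x + v y
  add : ∀ x y, min (v x) (v y) ≤ v (x + y)

def VGe {L : Type*} (v : L → WithTop ℤ) (x : L) (a : ℤ) : Prop := (a : WithTop ℤ) ≤ v x
def VEq {L : Type*} (v : L → WithTop ℤ) (x : L) (a : ℤ) : Prop := v x = (a : WithTop ℤ)

section valAPI
variable {L : Type*} [Field L] {v : L → WithTop ℤ}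

theorem VEq.ge {x : L} {a : ℤ} (h : VEq v x a) : VGe v x a := le_of_eq h.symm
theorem VEq.ge' {x : L} {a b : ℤ} (h : VEq v x a) (hb : b ≤ a) : VGe v x b := by
  unfold VGe; rw [h]; exact_mod_cast hb
theorem VGe.mono {x : L} {a b : ℤ} (h : VGe v x a) (hb : b ≤ a) : VGe v x b :=
  le_trans (by exact_mod_cast hb) h
theorem VEq.unique {x : L} {a b : ℤ} (h : VEq v x a) (h' : VEq v x b) : a = b := by
  unfold VEq at h h'; rw [h] at h'; exact_mod_cast h'
theorem VEq.le {x : L} {a b : ℤ} (h : VEq v x a) (h' : VGe v x b) : b ≤ a := by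
  unfold VGe at h'; rw [h] at h'; exact_mod_cast h'
theorem VEq.cast {x : L} {a b : ℤ} (h : VEq v x a) (hb : a = b) : VEq v x b := hb ▸ h

namespace VV

theorem zero (hv : VV v) (a : ℤ) : VGe v 0 a := by
  unfold VGe; rw [(hv.top 0).2 rfl]; exact le_top
theorem ex (hv : VV v) {x : L} (hx : x ≠ 0) : ∃ a, VEq v x a := by
  have : v x ≠ ⊤ := fun h => hx ((hv.top x).1 h)
  obtain ⟨a, ha⟩ := WithTop.ne_top_iff_exists.1 this
  exact ⟨a, ha.symm⟩
theorem ne (hv : VV v) {x : L} {a : ℤ} (h : VEq v x a) : x ≠ 0 := by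
  rintro rfl
  unfold VEq at h; rw [(hv.top 0).2 rfl] at h; exact WithTop.top_ne_coe h
theorem eqmul (hv : VV v) {x y : L} {a b : ℤ} (h : VEq v x a) (h' : VEq v y b) : VEq v (x * y) (a + b) := by
  unfold VEq at *; rw [hv.mul, h, h']; norm_cast
theorem gemul (hv : VV v) {x y : L} {a b : ℤ} (h : VGe v x a) (h' : VGe v y b) : VGe v (x * y) (a + b) := by
  unfold VGe at *; rw [hv.mul]; push_cast; exact add_le_add h h'
theorem one (hv : VV v) : VEq v 1 0 := by
  obtain ⟨a, ha⟩ := hv.ex (one_ne_zero (α := L))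
  have := hv.eqmul ha ha
  rw [one_mul] at this
  have := ha.unique this
  have : a = 0 := by omega
  subst this; exact ha
theorem eqpow (hv : VV v) {x : L} {a : ℤ} (h : VEq v x a) (n : ℕ) : VEq v (x ^ n) (n * a) := by
  induction n with
  | zero => simpa using hv.one
  | succ n ih => rw [pow_succ]; exact (hv.eqmul ih h).cast (by push_cast; ring)
theorem gepow (hv : VV v) {x : L} {a : ℤ} (h : VGe v x a) (n : ℕ) : VGe v (x ^ n) (n * a) := by
  induction n with
  | zero => simpa using hv.one.ge
  | succ n ih => rw [pow_succ]; exact (hv.gemul ih h).mono (by push_cast; linarith)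
theorem pow_inv (hv : VV v) {x : L} {a : ℤ} {n : ℕ} (hn : n ≠ 0) (h : VEq v (x^n) (n * a)) : VEq v x a := by
  have hx : x ≠ 0 := by
    rintro rfl
    rw [zero_pow hn] at h; exact hv.ne h rfl
  obtain ⟨b, hb⟩ := hv.ex hx
  have := (hv.eqpow hb n).unique h
  have : b = a := by
    have hn' : (n:ℤ) ≠ 0 := by exact_mod_cast hn
    exact mul_left_cancel₀ hn' this
  exact this ▸ hb
theorem neg_one (hv : VV v) : VEq v (-1) 0 := by
  apply hv.pow_inv (n := 2) (by norm_num)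
  simpa using hv.one
theorem eqneg (hv : VV v) {x : L} {a : ℤ} (h : VEq v x a) : VEq v (-x) a := by
  rw [← neg_one_mul]; exact (hv.eqmul hv.neg_one h).cast (by ring)
theorem geneg (hv : VV v) {x : L} {a : ℤ} (h : VGe v x a) : VGe v (-x) a := by
  rw [← neg_one_mul]; exact (hv.gemul hv.neg_one.ge h).mono (by linarith)
theorem geadd (hv : VV v) {x y : L} {a : ℤ} (h : VGe v x a) (h' : VGe v y a) : VGe v (x + y) a :=
  le_trans (le_min h h') (hv.add x y)
theorem gesub (hv : VV v) {x y : L} {a : ℤ} (h : VGe v x a) (h' : VGe v y a) : VGe v (x - y) a := by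
  rw [sub_eq_add_neg]; exact hv.geadd h (hv.geneg h')
theorem eqadd (hv : VV v) {x y : L} {a b : ℤ} (h : VEq v x a) (h' : VGe v y b) (hab : a < b) : VEq v (x + y) a := by
  have h1 : VGe v (x + y) a := hv.geadd h.ge (h'.mono hab.le)
  have hne : x + y ≠ 0 := by
    intro h0
    have : x = -y := by linear_combination h0
    have h2 := h.le (this ▸ hv.geneg h'); omega
  obtain ⟨c, hc⟩ := hv.ex hne
  have h2 := hc.le h1
  rcases eq_or_lt_of_le h2 with h3 | h3
  · exact h3 ▸ hc
  · exfalso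
    have h4 : VGe v (x + y - y) (a+1) := hv.gesub (hc.ge' (by omega)) (h'.mono (by omega))
    rw [add_sub_cancel_right] at h4
    have := h.le h4; omega
theorem eqadd' (hv : VV v) {x y : L} {a b : ℤ} (h : VGe v x b) (h' : VEq v y a) (hab : a < b) : VEq v (x + y) a := by
  rw [add_comm]; exact hv.eqadd h' h hab
theorem eqsub (hv : VV v) {x y : L} {a b : ℤ} (h : VEq v x a) (h' : VGe v y b) (hab : a < b) : VEq v (x - y) a := by
  rw [sub_eq_add_neg]; exact hv.eqadd h (hv.geneg h') hab
theorem eqinv (hv : VV v) {x : L} {a : ℤ} (h : VEq v x a) : VEq v x⁻¹ (-a) := by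
  have hx := hv.ne h
  obtain ⟨b, hb⟩ := hv.ex (inv_ne_zero hx)
  have := hv.eqmul h hb
  rw [mul_inv_cancel₀ hx] at this
  have := hv.one.unique this
  exact hb.cast (by omega)
theorem eqzpow (hv : VV v) {x : L} {a : ℤ} (h : VEq v x a) (n : ℤ) : VEq v (x ^ n) (n * a) := by
  obtain ⟨m, rfl | rfl⟩ := n.eq_nat_or_neg
  · rw [zpow_natCast]; exact hv.eqpow h m
  · rw [zpow_neg, zpow_natCast]; exact (hv.eqinv (hv.eqpow h m)).cast (by ring)
theorem gesum (hv : VV v) {ι : Type*} (s : Finset ι) (f : ι → L) (a : ℤ) (h : ∀ i ∈ s, VGe v (f i) a) :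
    VGe v (∑ i ∈ s, f i) a := by
  induction s using Finset.induction_on with
  | empty => simpa using hv.zero a
  | insert i s hi ih =>
    rw [Finset.sum_insert hi]
    exact hv.geadd (h i (Finset.mem_insert_self _ _)) (ih fun j hj => h j (Finset.mem_insert_of_mem hj))

/-- sums of terms with distinct valuations -/
theorem distinct (hv : VV v) {ι : Type*} (s : Finset ι) (f : ι → L)
    (hd : ∀ i ∈ s, ∀ j ∈ s, ∀ a, VEq v (f i) a → VEq v (f j) a → i = j) :
    (∀ i ∈ s, f i = 0) ∨ ∃ i ∈ s, ∃ a, VEq v (f i) a ∧ VEq v (∑ i ∈ s, f i) a ∧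
      ∀ j ∈ s, j ≠ i → VGe v (f j) (a+1) := by
  induction s using Finset.induction_on with
  | empty => left; simp
  | insert i s hi ih =>
    have ih' := ih (fun i hi j hj => hd i (Finset.mem_insert_of_mem hi) j (Finset.mem_insert_of_mem hj))
    rw [Finset.sum_insert hi]
    by_cases hfi : f i = 0
    · rcases ih' with h | ⟨i0, hi0, a, h1, h2, h3⟩
      · left
        intro j hj
        rcases Finset.mem_insert.1 hj with rfl | hj
        · exact hfi
        · exact h j hj
      · right
        refine ⟨i0, Finset.mem_insert_of_mem hi0, a, h1, by rwa [hfi, zero_add], ?_⟩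
        intro j hj hne
        rcases Finset.mem_insert.1 hj with rfl | hj
        · rw [hfi]; exact hv.zero _
        · exact h3 j hj hne
    · obtain ⟨b, hb⟩ := hv.ex hfi
      right
      rcases ih' with h | ⟨i0, hi0, a, h1, h2, h3⟩
      · refine ⟨i, Finset.mem_insert_self _ _, b, hb, by rwa [Finset.sum_eq_zero h, add_zero], ?_⟩
        intro j hj hne
        rcases Finset.mem_insert.1 hj with rfl | hj
        · exact absurd rfl hne
        · rw [h j hj]; exact hv.zero _
      · have hne : i ≠ i0 := by rintro rfl; exact hi hi0
        rcases lt_trichotomy a b with hab | hab | hab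
        · refine ⟨i0, Finset.mem_insert_of_mem hi0, a, h1, hv.eqadd' hb.ge h2 hab, ?_⟩
          intro j hj hne
          rcases Finset.mem_insert.1 hj with rfl | hj
          · exact hb.ge' (by omega)
          · exact h3 j hj hne
        · subst hab
          exact absurd (hd i (Finset.mem_insert_self _ _) i0 (Finset.mem_insert_of_mem hi0) _ hb h1) hne
        · refine ⟨i, Finset.mem_insert_self _ _, b, hb, hv.eqadd hb h2.ge hab, ?_⟩
          intro j hj hne
          rcases Finset.mem_insert.1 hj with rfl | hj
          · exact absurd rfl hne
          · by_cases hji : j = i0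
            · subst hji; exact h1.ge' (by omega)
            · exact (h3 j hj hji).mono (by omega)

theorem frobfix (hv : VV v) {p : ℕ} (hp : 2 ≤ p) {c : L} (hc : c ^ p = c) (h0 : c ≠ 0) : VEq v c 0 := by
  obtain ⟨a, ha⟩ := hv.ex h0
  have h := hv.eqpow ha p
  rw [hc] at h
  have := ha.unique h
  have h2 : ((p:ℤ) - 1) * a = 0 := by linarith
  rcases mul_eq_zero.1 h2 with h3 | h3
  · omega
  · exact ha.cast h3

theorem natunit (hv : VV v) {p : ℕ} [hp : Fact p.Prime] [CharP L p] {n : ℕ} (hn : ¬ p ∣ n) : VEq v (n : L) 0 := by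
  apply hv.frobfix (p := p) hp.out.two_le
  · exact map_natCast (frobenius L p) n
  · rwa [Ne, CharP.cast_eq_zero_iff L p]

theorem natge (hv : VV v) {p : ℕ} [hp : Fact p.Prime] [CharP L p] (n : ℕ) : VGe v (n : L) 0 := by
  by_cases hn : p ∣ n
  · rw [(CharP.cast_eq_zero_iff L p n).2 hn]; exact hv.zero _
  · exact (hv.natunit hn).ge

theorem one_add_pow (hv : VV v) {p : ℕ} [hp : Fact p.Prime] [CharP L p] {ε : L} {C : ℤ} (hC : 0 ≤ C)
    (h : VGe v ε C) (i : ℕ) : ∃ r, (1 + ε)^i = 1 + i * ε + r ∧ VGe v r (2 * C) := by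
  induction i with
  | zero => exact ⟨0, by simp, hv.zero _⟩
  | succ i ih =>
    obtain ⟨r, hr, hr'⟩ := ih
    refine ⟨i * (ε * ε) + r + r * ε, by rw [pow_succ, hr]; push_cast; ring, ?_⟩
    refine hv.geadd (hv.geadd ?_ hr') ?_
    · exact (hv.gemul (hv.natge (p := p) i) (hv.gemul h h)).mono (by omega)
    · exact (hv.gemul hr' h).mono (by omega)

/-- valuation of `(x+δ)^i - x^i` -/
theorem powdiff (hv : VV v) {p : ℕ} [hp : Fact p.Prime] [CharP L p] {x δ : L} {a C : ℤ} (hx : VEq v x a)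
    (hC : 0 < C) (hδ : VEq v δ (a + C)) (i : ℕ) :
    VGe v ((x + δ)^i - x^i) (i * a + C) ∧ (¬ p ∣ i → VEq v ((x + δ)^i - x^i) (i * a + C)) := by
  have hx0 := hv.ne hx
  have hε : VEq v (δ * x⁻¹) C := (hv.eqmul hδ (hv.eqinv hx)).cast (by ring)
  obtain ⟨r, hr, hr'⟩ := hv.one_add_pow (p := p) hC.le hε.ge i
  have key : (x + δ)^i - x^i = x^i * (i * (δ * x⁻¹) + r) := by
    have : x + δ = x * (1 + δ * x⁻¹) := by field_simp
    rw [this, mul_pow, hr]; ring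
  rw [key]
  constructor
  · refine hv.gemul (hv.eqpow hx i).ge (hv.geadd ?_ (hr'.mono (by omega)))
    exact (hv.gemul (hv.natge (p := p) i) hε.ge).mono (by omega)
  · intro hi
    refine hv.eqmul (hv.eqpow hx i) (hv.eqadd ?_ hr' (by omega))
    exact (hv.eqmul (hv.natunit hi) hε).cast (by ring)

end VV
end valAPI


section step
variable {K L : Type*} [Field K] [Field L] [Algebra K L]

/-- the intermediate field `M(y)` over `K` -/
def stepF (M : IntermediateField K L) (y : L) : IntermediateField K L :=
  (IntermediateField.adjoin M {y}).restrictScalars K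

theorem le_stepF (M : IntermediateField K L) (y : L) : M ≤ stepF M y := by
  intro z hz
  exact (IntermediateField.adjoin M {y}).algebraMap_mem ⟨z, hz⟩

theorem mem_stepF (M : IntermediateField K L) (y : L) : y ∈ stepF M y :=
  IntermediateField.mem_adjoin_simple_self M y

open Polynomial in
theorem stepF_expand {p : ℕ} (hp : 2 ≤ p) (M : IntermediateField K L) {y : L} (hy : y ^ p - y ∈ M)
    {z : L} (hz : z ∈ stepF M y) :
    ∃ c : ℕ → L, (∀ i, c i ∈ M) ∧ z = ∑ i ∈ Finset.range p, c i * y ^ i := by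
  set a0 : M := ⟨y ^ p - y, hy⟩ with ha0
  set g : M[X] := X ^ p - (X + C a0) with hg
  have hdeg : (X + C a0 : M[X]).degree < p := by
    rw [degree_X_add_C]; exact_mod_cast (by omega : 1 < p)
  have hmon : g.Monic := monic_X_pow_sub hdeg
  have hnd : g.natDegree = p := by
    rw [hg]
    rw [natDegree_sub_eq_left_of_natDegree_lt]
    · exact natDegree_X_pow p
    · rw [natDegree_X_pow, natDegree_X_add_C]; omega
  have hroot : aeval y g = 0 := by
    simp only [hg, map_sub, map_add, map_pow, aeval_X, aeval_C]
    have : algebraMap M L a0 = y ^ p - y := rfl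
    rw [this]; ring
  have hIntg : IsIntegral M y := ⟨g, hmon, by simpa [aeval_def] using hroot⟩
  have hz' : z ∈ (IntermediateField.adjoin M {y}).toSubalgebra := hz
  rw [IntermediateField.adjoin_simple_toSubalgebra_of_isAlgebraic hIntg.isAlgebraic,
    Algebra.adjoin_singleton_eq_range_aeval] at hz'
  obtain ⟨f, hf⟩ := hz'
  have hf : aeval y f = z := hf
  have h1 : aeval y (f %ₘ g) = z := by
    rw [aeval_modByMonic_eq_self_of_root hroot, hf]
  have h2 : (f %ₘ g).natDegree < p := by
    have h3 : g ≠ 1 := by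
      intro h; rw [h, natDegree_one] at hnd; omega
    have := natDegree_modByMonic_lt f hmon h3
    rwa [hnd] at this
  refine ⟨fun i => ((f %ₘ g).coeff i : M), fun i => ((f %ₘ g).coeff i).2, ?_⟩
  rw [← h1, aeval_eq_sum_range' h2]
  refine Finset.sum_congr rfl fun i _ => ?_
  rw [Algebra.smul_def]; rfl

/-- data of a totally ramified layer. -/
structure MP (v : L → WithTop ℤ) (M : IntermediateField K L) (p : ℕ) (E : ℤ) : Prop where
  pos : 0 < E
  vals : ∀ z ∈ M, z ≠ 0 → ∃ k, VEq v z (E * k)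
  unif : ∃ z ∈ M, VEq v z E
  res : ∀ z ∈ M, VEq v z 0 → ∃ d ∈ M, VGe v (z - d ^ p) 1

theorem term_val {v : L → WithTop ℤ} (hv : VV v) {M : IntermediateField K L} {p : ℕ} {E E' b : ℤ}
    (hM : MP v M p E) (hE : E = p * E') {y : L} (hy : VEq v y (-(E' * b))) {c : L} (hc : c ∈ M)
    (i : ℕ) {a : ℤ} (ha : VEq v (c * y ^ i) a) : ∃ k : ℤ, VEq v c (E * k) ∧ a = E' * (p * k - i * b) := by
  have hc0 : c ≠ 0 := by
    rintro rfl; rw [zero_mul] at ha; exact hv.ne ha rfl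
  obtain ⟨k, hk⟩ := hM.vals c hc hc0
  refine ⟨k, hk, ha.unique ((hv.eqmul hk (hv.eqpow hy i)).cast ?_)⟩
  rw [hE]; ring

theorem terms_distinct {v : L → WithTop ℤ} (hv : VV v) {M : IntermediateField K L} {p : ℕ} (hp : p.Prime)
    {E E' b : ℤ} (hb : ¬ (p:ℤ) ∣ b)
    (hM : MP v M p E) (hE : E = p * E') {y : L} (hy : VEq v y (-(E' * b))) {c : ℕ → L} (hc : ∀ i, c i ∈ M) :
    (∀ i ∈ Finset.range p, c i * y ^ i = 0) ∨ ∃ i ∈ Finset.range p, ∃ a, VEq v (c i * y ^ i) a ∧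
      VEq v (∑ i ∈ Finset.range p, c i * y ^ i) a ∧
      ∀ j ∈ Finset.range p, j ≠ i → VGe v (c j * y ^ j) (a+1) := by
  apply hv.distinct
  intro i hi j hj a h1 h2
  obtain ⟨k, _, hk⟩ := term_val hv hM hE hy (hc i) i h1
  obtain ⟨l, _, hl⟩ := term_val hv hM hE hy (hc j) j h2
  have hE' : E' ≠ 0 := by
    rintro rfl; have := hM.pos; simp [hE] at this
  have h3 : (p * k - i * b : ℤ) = p * l - j * b := mul_left_cancel₀ hE' (hk ▸ hl)
  have h4 : (p:ℤ) ∣ ((i:ℤ) - j) * b := ⟨k - l, by linarith⟩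
  have hp' : Prime (p:ℤ) := Nat.prime_iff_prime_int.1 hp
  rcases hp'.dvd_or_dvd h4 with h | h
  · rw [Finset.mem_range] at hi hj
    have := Int.eq_zero_of_abs_lt_dvd h (by rw [abs_lt]; omega)
    omega
  · exact absurd h hb

theorem MP.step {v : L → WithTop ℤ} (hv : VV v) {M : IntermediateField K L} {p : ℕ} (hp : p.Prime)
    {E E' b : ℤ} (hb : ¬ (p:ℤ) ∣ b)
    (hM : MP v M p E) (hE : E = p * E') {y : L} (hy : VEq v y (-(E' * b))) (hyM : y ^ p - y ∈ M) :
    MP v (stepF M y) p E' := by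
  have hE' : 0 < E' := by
    have h1 := hM.pos; have h2 : 0 < (p:ℤ) := by exact_mod_cast hp.pos
    rw [hE] at h1; exact (mul_pos_iff_of_pos_left h2).1 h1
  refine ⟨hE', ?_, ?_, ?_⟩
  · intro z hz hz0
    obtain ⟨c, hc, rfl⟩ := stepF_expand hp.two_le M hyM hz
    rcases terms_distinct hv hp hb hM hE hy hc with h | ⟨i, hi, a, h1, h2, h3⟩
    · exact absurd (Finset.sum_eq_zero h) hz0
    · obtain ⟨k, _, hk⟩ := term_val hv hM hE hy (hc i) i h1
      exact ⟨_, hk ▸ h2⟩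
  · obtain ⟨t, ht, ht'⟩ := hM.unif
    have hcop : IsCoprime (p:ℤ) b := (Prime.coprime_iff_not_dvd (Nat.prime_iff_prime_int.1 hp)).2 hb
    obtain ⟨r, s, hrs⟩ := hcop
    refine ⟨t ^ r * y ^ (-s), mul_mem (zpow_mem (le_stepF M y ht) _) (zpow_mem (mem_stepF M y) _), ?_⟩
    refine (hv.eqmul (hv.eqzpow ht' r) (hv.eqzpow hy (-s))).cast ?_
    rw [hE]; linear_combination E' * hrs
  · intro z hz hz0
    obtain ⟨c, hc, rfl⟩ := stepF_expand hp.two_le M hyM hz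
    rcases terms_distinct hv hp hb hM hE hy hc with h | ⟨i, hi, a, h1, h2, h3⟩
    · exact absurd (Finset.sum_eq_zero h) (hv.ne hz0)
    · have ha := h2.unique hz0
      subst ha
      obtain ⟨k, hk1, hk⟩ := term_val hv hM hE hy (hc i) i h1
      have h4 : (p * k - i * b : ℤ) = 0 := by
        rcases mul_eq_zero.1 hk.symm with h | h
        · omega
        · exact h
      have h5 : (p:ℤ) ∣ i * b := ⟨k, by linarith⟩
      have hp' : Prime (p:ℤ) := Nat.prime_iff_prime_int.1 hp
      have hi0 : i = 0 := by
        rcases hp'.dvd_or_dvd h5 with h | h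
        · rw [Finset.mem_range] at hi
          by_contra hne
          have := Nat.le_of_dvd (by omega) (Int.natCast_dvd_natCast.1 h)
          omega
        · exact absurd h hb
      subst hi0
      rw [pow_zero, mul_one] at h1
      obtain ⟨d, hd, hd'⟩ := hM.res _ (hc 0) h1
      refine ⟨d, le_stepF M y hd, ?_⟩
      rw [← Finset.add_sum_erase _ _ hi, pow_zero, mul_one, add_sub_right_comm]
      refine hv.geadd hd' (hv.gesum _ _ _ ?_)
      intro j hj
      rw [Finset.mem_erase] at hj
      exact (h3 j hj.2 hj.1).mono (by omega)

theorem stepF_finrank {v : L → WithTop ℤ} (hv : VV v) {M : IntermediateField K L} {p : ℕ} (hp : p.Prime)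
    {E E' b : ℤ} (hb : ¬ (p:ℤ) ∣ b) [FiniteDimensional K L]
    (hM : MP v M p E) (hE : E = p * E') {y : L} (hy : VEq v y (-(E' * b))) (hyM : y ^ p - y ∈ M) :
    Module.finrank K (stepF M y) = p * Module.finrank K M := by
  have hy' := mem_stepF M y
  let φ : (Fin p → M) →ₗ[K] stepF M y :=
    { toFun := fun c => ⟨∑ i : Fin p, (c i : L) * y ^ (i:ℕ),
        sum_mem fun i _ => mul_mem (le_stepF M y (c i).2) (pow_mem hy' _)⟩
      map_add' := by
        intro c d; apply Subtype.ext
        simp [add_mul, Finset.sum_add_distrib]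
      map_smul' := by
        intro r c; apply Subtype.ext
        simp [Finset.smul_sum] }
  have hinj : Function.Injective φ := by
    rw [← LinearMap.ker_eq_bot, LinearMap.ker_eq_bot']
    intro c hc
    have hc' : ∑ i : Fin p, (c i : L) * y ^ (i:ℕ) = 0 := congrArg Subtype.val hc
    set c' : ℕ → L := fun i => if h : i < p then (c ⟨i, h⟩ : L) else 0 with hc'd
    have hcm : ∀ i, c' i ∈ M := by
      intro i; simp only [hc'd]; split_ifs with h
      · exact (c ⟨i, h⟩).2
      · exact zero_mem _
    have hs : ∑ i ∈ Finset.range p, c' i * y ^ i = 0 := by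
      rw [Finset.sum_range, ← hc']
      refine Finset.sum_congr rfl fun i _ => ?_
      simp [hc'd]
    rcases terms_distinct hv hp hb hM hE hy hcm with h | ⟨i, hi, a, h1, h2, h3⟩
    · ext i
      have := h i (Finset.mem_range.2 i.2)
      have hy0 := hv.ne hy
      have := (mul_eq_zero.1 this).resolve_right (pow_ne_zero _ hy0)
      simpa [hc'd] using this
    · exact absurd hs (hv.ne h2)
  have hsurj : Function.Surjective φ := by
    rintro ⟨z, hz⟩
    obtain ⟨c, hc, rfl⟩ := stepF_expand hp.two_le M hyM hz
    refine ⟨fun i => ⟨c i, hc i⟩, Subtype.ext ?_⟩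
    change ∑ i : Fin p, c i * y ^ (i:ℕ) = _
    exact (Finset.sum_range (fun i => c i * y ^ i)).symm
  rw [← (LinearEquiv.ofBijective φ ⟨hinj, hsurj⟩).finrank_eq]
  rw [Module.finrank_pi_fintype]; simp

end step


section rootapprox
variable {K L : Type*} [Field K] [Field L] [Algebra K L]

/-- hypotheses of one Artin-Schreier layer -/
structure ASL (v : L → WithTop ℤ) (M : IntermediateField K L) (p : ℕ) (E E' b : ℤ) (y : L) : Prop where
  hv : VV v
  hp : p.Prime
  hb : ¬ (p:ℤ) ∣ b
  bpos : 0 < b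
  hM : MP v M p E
  hE : E = p * E'
  hy : VEq v y (-(E' * b))
  hyM : y ^ p - y ∈ M

theorem ASL.E'pos {v : L → WithTop ℤ} {M : IntermediateField K L} {p : ℕ} {E E' b : ℤ} {y : L}
    (H : ASL v M p E E' b y) : 0 < E' := by
  have h1 := H.hM.pos; have h2 : 0 < (p:ℤ) := by exact_mod_cast H.hp.pos
  rw [H.hE] at h1; exact (mul_pos_iff_of_pos_left h2).1 h1

theorem ASL.a0val {v : L → WithTop ℤ} {M : IntermediateField K L} {p : ℕ} {E E' b : ℤ} {y : L}
    (H : ASL v M p E E' b y) : VEq v (y ^ p - y) (-(E * b)) := by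
  have hβ : 0 < E' * b := mul_pos H.E'pos H.bpos
  have h2 : (2:ℤ) ≤ p := by exact_mod_cast H.hp.two_le
  have h1 := H.hv.eqpow H.hy p
  refine (H.hv.eqsub h1 H.hy.ge ?_).cast ?_
  · nlinarith
  · rw [H.hE]; ring

theorem ASL.single {v : L → WithTop ℤ} {M : IntermediateField K L} {p : ℕ} [Fact p.Prime] [CharP L p]
    {E E' b : ℤ} {y : L}
    (H : ASL v M p E E' b y) {f : L} (hf : f ∈ M) {k : ℤ} (hfv : VEq v f (E * k)) :
    ∃ s ∈ stepF M y, ∃ f' ∈ M, VEq v (s ^ p) (E * k) ∧ VGe v f' (E * k + 1) ∧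
      VGe v (f - f' - s ^ p) (E * k + (p - 1) * (E' * b)) ∧
      (¬ (p:ℤ) ∣ k → VEq v (f - f' - s ^ p) (E * k + (p - 1) * (E' * b))) := by
  have hv := H.hv
  have hp' : Prime (p:ℤ) := Nat.prime_iff_prime_int.1 H.hp
  have h2 : (2:ℤ) ≤ p := by exact_mod_cast H.hp.two_le
  have hβ : 0 < E' * b := mul_pos H.E'pos H.bpos
  -- choose j
  obtain ⟨j, l, hj⟩ : ∃ j : ℕ, ∃ l : ℤ, k + b * j = p * l := by
    obtain ⟨r, s, hrs⟩ := (Prime.coprime_iff_not_dvd hp').2 H.hb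
    refine ⟨((-k * s) % p).toNat, ?_⟩
    have h0 : 0 ≤ (-k * s) % p := Int.emod_nonneg _ (by omega)
    rw [Int.toNat_of_nonneg h0]
    have h3 := Int.emod_add_mul_ediv (-k*s) p
    set q := (-k*s) / (p:ℤ)
    refine ⟨k * r - b * q, ?_⟩
    have h4 : (-k * s) % (p:ℤ) = -k * s - p * q := by linarith
    rw [h4]; linear_combination -k * hrs
  obtain ⟨t, ht, htv⟩ := H.hM.unif
  set a0 := y ^ p - y with ha0
  have ha0v : VEq v a0 (-(E*b)) := H.a0val
  set h := t ^ l with hh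
  have hhM : h ∈ M := zpow_mem ht l
  have hhv : VEq v h (E * l) := (hv.eqzpow htv l).cast (by ring)
  set g := h ^ p * a0 ^ j with hg
  have hgv : VEq v g (E * k) := by
    refine (hv.eqmul (hv.eqpow hhv p) (hv.eqpow ha0v j)).cast ?_
    linear_combination (-E) * hj
  have hgM : g ∈ M := mul_mem (pow_mem hhM _) (pow_mem H.hyM _)
  have hg0 := hv.ne hgv
  have hwv : VEq v (f * g⁻¹) 0 := (hv.eqmul hfv (hv.eqinv hgv)).cast (by ring)
  obtain ⟨d, hd, hd'⟩ := H.hM.res _ (mul_mem hf (inv_mem hgM)) hwv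
  have hdp : VEq v (d ^ p) 0 := by
    have := hv.eqsub hwv hd' (by norm_num)
    rwa [sub_sub_cancel] at this
  have hdhp : VEq v ((d * h)^p) (p * (E * l)) := by
    rw [mul_pow]; exact (hv.eqmul hdp (hv.eqpow hhv p)).cast (by ring)
  have hs : (d * h * y ^ j) ^ p = (d * h)^p * (y^p)^j := by
    rw [mul_pow, ← pow_mul, ← pow_mul, mul_comm j p]
  have hkey : f - (f * g⁻¹ - d ^ p) * g - (d * h * y ^ j) ^ p
      = (d*h)^p * ((y^p + (-y)) ^ j - (y^p)^j) := by
    rw [hs, ← sub_eq_add_neg, ← ha0, sub_mul, inv_mul_cancel_right₀ hg0, hg]; ring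
  have hyp : VEq v (y^p) (-(p * (E' * b))) := (hv.eqpow H.hy p).cast (by ring)
  have hpd := hv.powdiff (p := p) hyp (C := (p-1) * (E'*b)) (mul_pos (by omega) hβ)
    ((hv.eqneg H.hy).cast (by ring)) j
  have hidx : (p:ℤ) * (E * l) + (j * (-(p * (E' * b))) + (p-1) * (E'*b)) = E * k + (p-1) * (E'*b) := by
    have : (E:ℤ) * k = E * (p * l - b * j) := by rw [← hj]; ring
    rw [this, H.hE]; ring
  refine ⟨d * h * y ^ j, mul_mem (le_stepF M y (mul_mem hd hhM)) (pow_mem (mem_stepF M y) _),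
    (f * g⁻¹ - d ^ p) * g, mul_mem (sub_mem (mul_mem hf (inv_mem hgM)) (pow_mem hd _)) hgM, ?_, ?_, ?_, ?_⟩
  · rw [hs]
    refine (hv.eqmul hdhp (hv.eqpow hyp j)).cast ?_
    linarith
  · exact (hv.gemul hd' hgv.ge).mono (by omega)
  · rw [hkey]
    exact (hv.gemul hdhp.ge hpd.1).mono hidx.ge
  · intro hk
    rw [hkey]
    refine (hv.eqmul hdhp (hpd.2 ?_)).cast hidx
    intro hpj
    apply hk
    have h5 : (p:ℤ) ∣ b * j := Dvd.dvd.mul_left (Int.natCast_dvd_natCast.2 hpj) _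
    have h6 : k = p * l - b * j := by linarith
    rw [h6]; exact dvd_sub (dvd_mul_right _ _) h5

theorem add_pow_p' {p : ℕ} [Fact p.Prime] [CharP L p] (x y : L) : (x + y)^p = x^p + y^p :=
  map_add (frobenius L p) x y

theorem ASL.weak {v : L → WithTop ℤ} {M : IntermediateField K L} {p : ℕ} [Fact p.Prime] [CharP L p]
    {E E' b : ℤ} {y : L}
    (H : ASL v M p E E' b y) (a : ℤ) (N : ℕ) (hN : (N:ℤ) ≤ (p - 1) * (E' * b)) :
    ∀ f ∈ M, VGe v f (a + (p - 1) * (E' * b) - N) →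
    ∃ s ∈ stepF M y, VGe v (s ^ p) (a + (p - 1) * (E' * b) - N) ∧
      VGe v (f - s ^ p) (a + (p - 1) * (E' * b)) := by
  have hv := H.hv
  have hp0 : p ≠ 0 := H.hp.ne_zero
  induction N with
  | zero =>
    intro f hf hfv
    refine ⟨0, zero_mem _, ?_, ?_⟩
    · rw [zero_pow hp0]; exact hv.zero _
    · rw [zero_pow hp0, sub_zero]; simpa using hfv
  | succ N ih =>
    intro f hf hfv
    push_cast at hN
    by_cases hf0 : f = 0
    · refine ⟨0, zero_mem _, ?_, ?_⟩
      · rw [zero_pow hp0]; exact hv.zero _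
      · rw [zero_pow hp0, sub_zero, hf0]; exact hv.zero _
    obtain ⟨k, hk⟩ := H.hM.vals f hf hf0
    have hle := hk.le hfv
    push_cast at hle
    obtain ⟨s, hs, f', hf', h1, h2, h3, -⟩ := H.single hf hk
    obtain ⟨s', hs', h4, h5⟩ := ih (by omega) f' hf' (h2.mono (by omega))
    refine ⟨s + s', add_mem hs hs', ?_, ?_⟩
    · rw [add_pow_p']
      push_cast
      exact hv.geadd (h1.ge' hle) (h4.mono (by omega))
    · have : f - (s + s')^p = (f' - s' ^ p) + (f - f' - s ^ p) := by rw [add_pow_p']; ring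
      rw [this]
      exact hv.geadd h5 (h3.mono (by omega))

/-- p-th root approximation -/
theorem ASL.root {v : L → WithTop ℤ} {M : IntermediateField K L} {p : ℕ} [Fact p.Prime] [CharP L p]
    {E E' b : ℤ} {y : L}
    (H : ASL v M p E E' b y) {f : L} (hf : f ∈ M) {k : ℤ} (hfv : VEq v f (E * k)) (hk : ¬ (p:ℤ) ∣ k) :
    ∃ s ∈ stepF M y, VEq v (s ^ p) (E * k) ∧ VEq v (f - s ^ p) (E * k + (p - 1) * (E' * b)) := by
  have hv := H.hv
  have hβ : 0 < E' * b := mul_pos H.E'pos H.bpos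
  have h2 : (2:ℤ) ≤ p := by exact_mod_cast H.hp.two_le
  have hC : 0 < (p - 1) * (E' * b) := mul_pos (by omega) hβ
  obtain ⟨s, hs, f', hf', h1, h2, -, h3⟩ := H.single hf hfv
  have hN : ((((p - 1) * (E' * b)).toNat : ℕ):ℤ) = (p - 1) * (E' * b) := Int.toNat_of_nonneg hC.le
  obtain ⟨s', hs', h4, h5⟩ := H.weak (E * k + 1) _ hN.le f' hf' (h2.mono (by omega))
  refine ⟨s + s', add_mem hs hs', ?_, ?_⟩
  · rw [add_pow_p']; exact hv.eqadd h1 h4 (by omega)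
  · have : f - (s + s')^p = (f' - s' ^ p) + (f - f' - s ^ p) := by rw [add_pow_p']; ring
    rw [this]
    exact hv.eqadd' h5 (h3 hk) (by omega)

end rootapprox


section wittval
variable {p : ℕ} [hp : Fact p.Prime]

theorem ww_trunc_eq {A : Type*} [CommRing A] {P Q : WittVector p A} {m : ℕ} :
    WittVector.truncate m P = WittVector.truncate m Q ↔ ∀ i < m, P.coeff i = Q.coeff i := by
  constructor
  · intro h i hi
    have h1 := congrArg (fun z => TruncatedWittVector.coeff (⟨i, hi⟩ : Fin m) z) h
    simpa [WittVector.coeff_truncate] using h1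
  · intro h
    ext i
    rw [WittVector.coeff_truncate, WittVector.coeff_truncate]; exact h i i.2

theorem ww_expr_congr {A : Type*} [CommRing A] {X Y Z X' Y' Z' : ℕ → A} {j : ℕ}
    (hX : ∀ i ≤ j, X i = X' i) (hY : ∀ i ≤ j, Y i = Y' i) (hZ : ∀ i ≤ j, Z i = Z' i) :
    (WittVector.mk p X - WittVector.mk p Y + WittVector.mk p Z).coeff j =
    (WittVector.mk p X' - WittVector.mk p Y' + WittVector.mk p Z').coeff j := by
  have : WittVector.truncate (j+1) (WittVector.mk p X - WittVector.mk p Y + WittVector.mk p Z) =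
      WittVector.truncate (j+1) (WittVector.mk p X' - WittVector.mk p Y' + WittVector.mk p Z') := by
    have e1 : WittVector.truncate (j+1) (WittVector.mk p X) = WittVector.truncate (j+1) (WittVector.mk p X') :=
      ww_trunc_eq.2 fun i hi => hX i (by omega)
    have e2 : WittVector.truncate (j+1) (WittVector.mk p Y) = WittVector.truncate (j+1) (WittVector.mk p Y') :=
      ww_trunc_eq.2 fun i hi => hY i (by omega)
    have e3 : WittVector.truncate (j+1) (WittVector.mk p Z) = WittVector.truncate (j+1) (WittVector.mk p Z') :=
      ww_trunc_eq.2 fun i hi => hZ i (by omega)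
    rw [map_add, map_sub, map_add, map_sub, e1, e2, e3]
  exact ww_trunc_eq.1 this j (by omega)

open Polynomial

/-- growth subring of `L[X]` -/
def growthRing {L : Type*} [Field L] (v : L → WithTop ℤ) (hv : VV v) (g : ℕ → ℤ) (g0 : g 0 = 0)
    (gadd : ∀ a b, g (a + b) ≤ g a + g b) : Subring L[X] where
  carrier := {f | ∀ d, VGe v (f.coeff d) (g d)}
  zero_mem' := by intro d; rw [coeff_zero]; exact hv.zero _
  one_mem' := by
    intro d
    rw [coeff_one]
    split_ifs with h
    · rw [h, g0]; exact hv.one.ge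
    · exact hv.zero _
  add_mem' := by
    intro a b ha hb d
    rw [coeff_add]; exact hv.geadd (ha d) (hb d)
  neg_mem' := by
    intro a ha d
    rw [coeff_neg]; exact hv.geneg (ha d)
  mul_mem' := by
    intro a b ha hb d
    rw [coeff_mul]
    refine hv.gesum _ _ _ ?_
    intro x hx
    rw [Finset.HasAntidiagonal.mem_antidiagonal] at hx
    exact (hv.gemul (ha _) (hb _)).mono (by rw [← hx]; exact gadd _ _)

theorem ww_val {L : Type*} [Field L] {v : L → WithTop ℤ} (hv : VV v) {w : L} (hw : VGe v w 0)
    (Y S T : ℕ → L) (A : ℕ → ℤ) (B : ℤ) (j : ℕ)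
    (hA : ∀ i ≤ j, (p:ℤ)^(j-i) * A i ≤ B)
    (hY : ∀ i ≤ j, VGe v (Y i) (-A i)) (hS : ∀ i ≤ j, VGe v (S i) (-A i))
    (hT : ∀ i ≤ j, VGe v (T i) (-A i)) :
    ∃ Q : L, VGe v Q (-B) ∧
    (WittVector.mk p (fun i => Y i + w * S i) - WittVector.mk p Y + WittVector.mk p (fun i => w * T i)).coeff j
      = w * ((∑ i ∈ Finset.range (j+1), Y i ^ (p^(j-i) - 1) * S i) + T j) + w^2 * Q := by
  have hp0 : (0:ℤ) < (p:ℤ)^j := pow_pos (by exact_mod_cast hp.out.pos) _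
  set g : ℕ → ℤ := fun d => -((B * d) / (p:ℤ)^j) with hg
  have g0 : g 0 = 0 := by simp [hg]
  have gadd : ∀ a b, g (a + b) ≤ g a + g b := by
    intro a b
    simp only [hg]
    have : (B * a) / (p:ℤ)^j + (B * b) / (p:ℤ)^j ≤ (B * (a + b : ℕ)) / (p:ℤ)^j := by
      rw [Int.le_ediv_iff_mul_le hp0]
      have h1 := Int.ediv_mul_le (B * a) hp0.ne'
      have h2 := Int.ediv_mul_le (B * b) hp0.ne'
      push_cast; linarith
    linarith
  have gtop : g (p^j) = -B := by
    simp only [hg]; push_cast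
    rw [Int.mul_ediv_cancel _ hp0.ne']
  have gi : ∀ i ≤ j, g (p^i) ≤ -A i := by
    intro i hi
    simp only [hg, neg_le_neg_iff]
    rw [Int.le_ediv_iff_mul_le hp0]
    have h1 := hA i hi
    have h2 : (p:ℤ)^j = p^(j-i) * p^i := by rw [← pow_add]; congr 1; omega
    have h3 : (0:ℤ) ≤ (p:ℤ)^i := by positivity
    rw [h2]; push_cast; nlinarith
  let R := growthRing v hv g g0 gadd
  have memX : ∀ (X : ℕ → L), (∀ i ≤ j, VGe v (X i) (-A i)) → ∀ i,
      (if i ≤ j then Polynomial.X ^ p^i * Polynomial.C (X i) else 0 : L[X]) ∈ R := by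
    intro X hX i
    split_ifs with hi
    · intro d
      rw [coeff_X_pow_mul', coeff_C]
      split_ifs with h1 h2
      · have : d = p^i := by omega
        rw [this]; exact (hX i hi).mono (gi i hi)
      · exact hv.zero _
      · exact hv.zero _
    · exact zero_mem _
  have memw : (Polynomial.C w : L[X]) ∈ R := by
    intro d
    rw [coeff_C]
    split_ifs with h
    · rw [h, g0]; exact hw
    · exact hv.zero _
  obtain ⟨Q, hQ⟩ := ww_univ (p := p) (A := R) ⟨_, memw⟩ (fun i => ⟨_, memX Y hY i⟩)
    (fun i => ⟨_, memX S hS i⟩) (fun i => ⟨_, memX T hT i⟩) j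
  refine ⟨(Q : L[X]).coeff (p^j), ?_, ?_⟩
  · have := Q.2 (p^j); rwa [gtop] at this
  have h1 := congrArg (R.subtype) hQ
  rw [← WittVector.map_coeff, map_add, map_sub, ww_map_mk, ww_map_mk, ww_map_mk] at h1
  have h2 : (WittVector.mk p (fun i => (X:L[X])^p^i * (C (Y i + w * S i))) - WittVector.mk p (fun i => X^p^i * C (Y i))
     + WittVector.mk p (fun i => X^p^i * C (w * T i))).coeff j = _ := (ww_expr_congr ?_ ?_ ?_).trans h1
  rotate_left
  · intro i hi
    simp [hi]; ring
  · intro i hi; simp [hi]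
  · intro i hi
    simp [hi]; ring
  rw [ww_homog] at h2
  have h3 : (WittVector.mk p (fun i => C (Y i + w * S i)) - WittVector.mk p (fun i => C (Y i))
     + WittVector.mk p (fun i => C (w * T i))).coeff j = (C : L →+* L[X])
       ((WittVector.mk p (fun i => Y i + w * S i) - WittVector.mk p Y + WittVector.mk p (fun i => w * T i)).coeff j) := by
    rw [← WittVector.map_coeff, map_add, map_sub, ww_map_mk, ww_map_mk, ww_map_mk]
  rw [h3] at h2
  set c := (WittVector.mk p (fun i => Y i + w * S i) - WittVector.mk p Y + WittVector.mk p (fun i => w * T i)).coeff j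
  have h4 : R.subtype (⟨C w, memw⟩ *
        (∑ i ∈ Finset.range (j + 1), (⟨_, memX Y hY i⟩ : R) ^ (p ^ (j - i) - 1) * ⟨_, memX S hS i⟩ +
          ⟨_, memX T hT j⟩) + ⟨C w, memw⟩ ^ 2 * Q) =
      X^p^j * C (w * ((∑ i ∈ Finset.range (j+1), Y i ^ (p^(j-i) - 1) * S i) + T j)) + C (w^2) * (Q : L[X]) := by
    simp only [map_add, map_mul, map_sum, map_pow, Subring.coe_subtype, le_refl, if_true]
    have : ∑ i ∈ Finset.range (j+1), (if i ≤ j then X ^ p^i * C (Y i) else 0 : L[X]) ^ (p ^ (j - i) - 1) *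
        (if i ≤ j then X ^ p^i * C (S i) else 0 : L[X]) =
        X^p^j * ∑ i ∈ Finset.range (j+1), C (Y i) ^ (p^(j-i) - 1) * C (S i) := by
      rw [Finset.mul_sum]
      refine Finset.sum_congr rfl fun i hi => ?_
      rw [Finset.mem_range] at hi
      have hi' : i ≤ j := by omega
      rw [if_pos hi', if_pos hi', mul_pow, ← pow_mul]
      have : p ^ j = p^i * (p^(j-i) - 1) + p^i := by
        have h5 : 0 < p^(j-i) := pow_pos hp.out.pos _
        have h6 : p^j = p^i * p^(j-i) := by rw [← pow_add]; congr 1; omega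
        rw [h6]
        obtain ⟨r, hr⟩ : ∃ r, p^(j-i) = r + 1 := ⟨p^(j-i)-1, by omega⟩
        rw [hr]; simp; ring
      rw [this, pow_add]; ring
    rw [this]; ring
  rw [h4] at h2
  have h5 := congrArg (fun f => f.coeff (p^j)) h2
  simp only [coeff_add, coeff_X_pow_mul', le_refl, if_true, Nat.sub_self, coeff_C_zero, coeff_C_mul] at h5
  exact h5

end wittval


section core
variable {K L : Type*} [Field K] [Field L] [Algebra K L]

theorem W_mono {p : ℕ} {W : ℕ → ℤ} {n : ℕ} (hW : ∀ j, j + 1 < n → p * W j ≤ W (j+1)) {i j : ℕ}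
    (hij : i ≤ j) (hj : j < n) : (p:ℤ)^(j-i) * W i ≤ W j := by
  obtain ⟨d, rfl⟩ := Nat.exists_eq_add_of_le hij
  rw [Nat.add_sub_cancel_left]
  induction d with
  | zero => simp
  | succ d ih =>
    have h1 := ih (by omega) (by omega)
    have h2 := hW (i+d) (by omega)
    have h3 : (0:ℤ) ≤ p := by positivity
    rw [pow_succ]
    calc (p:ℤ)^d * p * W i = p * (p^d * W i) := by ring
      _ ≤ p * W (i+d) := mul_le_mul_of_nonneg_left h1 h3
      _ ≤ _ := h2

theorem ASL.core {v : L → WithTop ℤ} {M : IntermediateField K L} {p : ℕ} [Fact p.Prime] [CharP L p]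
    {E E' b : ℤ} {y : L}
    (H : ASL v M p E E' b y) (a : ℕ → L) (W : ℕ → ℤ) (n : ℕ) (ha : ∀ j < n, a j ∈ M)
    (ha0 : a 0 = y ^ p - y) (hW0 : W 0 = b) (hW : ∀ j, j + 1 < n → p * W j ≤ W (j+1))
    (hc : ∀ j < n, (¬ (p:ℤ) ∣ W j ∧ VEq v (a j) (-(E * W j))) ∨
      (∃ i, j = i + 1 ∧ W j = p * W i ∧ VGe v (a j) (-(E * W j) + 1))) :
    ∃ s : ℕ → L, (∀ j, s j ∈ stepF M y) ∧ s 0 = y ∧ ∀ j, 1 ≤ j → j < n →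
      VEq v ((WittVector.mk p a - WittVector.mk p (fun i => s i ^ p) + WittVector.mk p s).coeff j)
        (-(E * W j) + (p - 1) * (E' * b)) := by
  have hv := H.hv
  have hβ : 0 < E' * b := mul_pos H.E'pos H.bpos
  have h2 : (2:ℤ) ≤ p := by exact_mod_cast H.hp.two_le
  have hppos : 0 < p := H.hp.pos
  set C : ℤ := (p - 1) * (E' * b) with hC
  have hCpos : 0 < C := mul_pos (by omega) hβ
  have hN : ((C.toNat : ℕ):ℤ) = C := Int.toNat_of_nonneg hCpos.le
  have hEpos := H.hM.pos
  have sel : ∀ j, ∃ s ∈ stepF M y, (j = 0 → s = y) ∧ (j < n →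
      ((¬ (p:ℤ) ∣ W j ∧ VEq v (s ^ p) (-(E * W j)) ∧ VEq v (a j - s ^ p) (-(E * W j) + C)) ∨
      (∃ i, j = i + 1 ∧ W j = p * W i ∧ VGe v (s ^ p) (-(E * W j) + 1) ∧
        VGe v (a j - s ^ p) (-(E * W j) + 1 + C)))) := by
    intro j
    by_cases hjn : j < n
    swap
    · exact ⟨y, mem_stepF M y, fun _ => rfl, fun h => absurd h hjn⟩
    by_cases hj0 : j = 0
    · subst hj0
      refine ⟨y, mem_stepF M y, fun _ => rfl, fun _ => Or.inl ⟨hW0 ▸ H.hb, ?_, ?_⟩⟩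
      · rw [hW0, H.hE]; exact (hv.eqpow H.hy p).cast (by ring)
      · have : a 0 - y ^ p = - y := by rw [ha0]; ring
        rw [this, hW0, H.hE]
        exact (hv.eqneg H.hy).cast (by rw [hC]; ring)
    · rcases hc j hjn with ⟨h1, h3⟩ | ⟨i, h1, h3, h4⟩
      · obtain ⟨s, hs, h5, h6⟩ := H.root (ha j hjn) (k := -W j) (h3.cast (by ring)) (by simpa using h1)
        refine ⟨s, hs, fun h => absurd h hj0, fun _ => Or.inl ⟨h1, h5.cast (by ring), h6.cast (by ring)⟩⟩
      · obtain ⟨s, hs, h5, h6⟩ := H.weak (-(E * W j) + 1) C.toNat hN.le (a j) (ha j hjn)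
          (h4.mono (by omega))
        refine ⟨s, hs, fun h => absurd h hj0, fun _ => Or.inr ⟨i, h1, h3, h5.mono (by omega), h6⟩⟩
  choose s hsM hs0 hs using sel
  refine ⟨s, hsM, hs0 0 rfl, ?_⟩
  intro j hj1 hjn
  have hmono : ∀ i ≤ j, (p:ℤ)^(j-i) * W i ≤ W j := fun i hi => W_mono hW hi hjn
  have hWpos : ∀ i < n, b ≤ W i ∧ (1 ≤ i → b < W i) := by
    intro i hi
    have h3 := W_mono hW (Nat.zero_le i) hi
    rw [hW0, Nat.sub_zero] at h3
    have h4 : (1:ℤ) ≤ (p:ℤ)^i := one_le_pow₀ (by omega)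
    have hb := H.bpos
    refine ⟨by nlinarith, fun h1 => ?_⟩
    have h5 : (2:ℤ) ≤ (p:ℤ)^i := by
      calc (2:ℤ) ≤ p := h2
        _ = (p:ℤ)^1 := (pow_one _).symm
        _ ≤ (p:ℤ)^i := pow_le_pow_right₀ (by omega) h1
    nlinarith
  have hspge : ∀ i < n, VGe v (s i ^ p) (-(E * W i)) := by
    intro i hi
    rcases hs i hi with h | ⟨_, _, _, h, _⟩
    · exact h.2.1.ge
    · exact h.mono (by omega)
  have hdge : ∀ i < n, VGe v (a i - s i ^ p) (-(E * W i) + C) := by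
    intro i hi
    rcases hs i hi with h | ⟨_, _, _, _, h⟩
    · exact h.2.2.ge
    · exact h.mono (by omega)
  have hsge : ∀ i < n, VGe v (s i) (-(E * W i) + C) ∧ (1 ≤ i → VGe v (s i) (-(E * W i) + C + 1)) := by
    intro i hi
    by_cases h0 : s i = 0
    · rw [h0]; exact ⟨hv.zero _, fun _ => hv.zero _⟩
    obtain ⟨c, hcv⟩ := hv.ex h0
    have h3 := (hv.eqpow hcv p).le (hspge i hi)
    obtain ⟨hw1, hw2⟩ := hWpos i hi
    have hEb : E * b = p * (E' * b) := by rw [H.hE]; ring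
    have h4 : E * b ≤ E * W i := mul_le_mul_of_nonneg_left hw1 hEpos.le
    have key : (p:ℤ) * (-(E * W i) + C) ≤ -(E * W i) - (p-1) * (E * W i - E * b) := by
      rw [hC, hEb]; nlinarith
    refine ⟨hcv.ge' ?_, fun h1 => hcv.ge' ?_⟩
    · have : (p:ℤ) * (-(E * W i) + C) ≤ p * c := by nlinarith
      exact le_of_mul_le_mul_left this (by omega)
    · have h5 : E * b < E * W i := mul_lt_mul_of_pos_left (hw2 h1) hEpos
      have : (p:ℤ) * (-(E * W i) + C) < p * c := by nlinarith
      have := lt_of_mul_lt_mul_left this (by omega)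
      omega
  -- the dominant index
  have dom : ∀ j < n, ∃ i0 ≤ j, ¬ (p:ℤ) ∣ W i0 ∧ W j = p^(j-i0) * W i0 ∧
      VEq v (s i0 ^ p) (-(E * W i0)) ∧ VEq v (a i0 - s i0 ^ p) (-(E * W i0) + C) ∧
      ∀ i, i0 < i → i ≤ j → W j = p^(j-i) * W i ∧ VGe v (a i - s i ^ p) (-(E * W i) + 1 + C) := by
    intro j
    induction j with
    | zero =>
      intro hj
      rcases hs 0 hj with h | ⟨i, hi, _⟩
      · exact ⟨0, le_rfl, h.1, by simp, h.2.1, h.2.2, fun i h1 h2 => by omega⟩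
      · omega
    | succ j ih =>
      intro hj
      rcases hs (j+1) hj with h | ⟨i, hi, h3, h4, h5⟩
      · exact ⟨j+1, le_rfl, h.1, by simp, h.2.1, h.2.2, fun i h1 h2 => by omega⟩
      · have hij : i = j := by omega
        subst hij
        obtain ⟨i0, hi0, g1, g2, g3, g4, g5⟩ := ih (by omega)
        refine ⟨i0, by omega, g1, ?_, g3, g4, ?_⟩
        · rw [h3, g2, Nat.succ_sub hi0, pow_succ]; ring
        · intro l hl1 hl2
          rcases Nat.lt_or_ge l (i+1) with h6 | h6
          · obtain ⟨g6, g7⟩ := g5 l hl1 (by omega)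
            refine ⟨?_, g7⟩
            rw [h3, g6, Nat.succ_sub (by omega), pow_succ]; ring
          · have : l = i + 1 := by omega
            subst this
            exact ⟨by simp, h5⟩
  obtain ⟨i0, hi0, d1, d2, d3, d4, d5⟩ := dom j hjn
  have hy0 : y ≠ 0 := hv.ne H.hy
  have hyp0 : y ^ (p-1) ≠ 0 := pow_ne_zero _ hy0
  have hpc : ((p - 1 : ℕ) : ℤ) = p - 1 := by omega
  have hypv : VEq v (y^(p-1)) (-C) := (hv.eqpow H.hy (p-1)).cast (by rw [hpc, hC]; ring)
  set w := (y ^ (p-1))⁻¹ with hw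
  have hwv : VEq v w C := (hv.eqinv hypv).cast (by ring)
  have hw0 : w ≠ 0 := hv.ne hwv
  have hwi : ∀ z : L, w * (z * y^(p-1)) = z := by
    intro z; rw [hw]; field_simp
  set S : ℕ → L := fun i => (a i - s i ^ p) * y^(p-1) with hS
  set T : ℕ → L := fun i => s i * y ^(p-1) with hT
  obtain ⟨Q, hQ, hQe⟩ := ww_val (p := p) hv (w := w) (hwv.ge' hCpos.le) (fun i => s i ^ p) S T
    (fun i => E * W i) (E * W j) j
    (fun i hi => by have := mul_le_mul_of_nonneg_left (hmono i hi) hEpos.le; linarith)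
    (fun i hi => hspge i (by omega))
    (fun i hi => (hv.gemul (hdge i (by omega)) hypv.ge).mono (by linarith))
    (fun i hi => (hv.gemul (hsge i (by omega)).1 hypv.ge).mono (by linarith))
  have e1 : (fun i => s i ^ p + w * S i) = a := by
    funext i; simp only [hS]; rw [hwi]; ring
  have e2 : (fun i => w * T i) = s := by
    funext i; simp only [hT]; rw [hwi]
  rw [e1, e2] at hQe
  rw [hQe]
  have hppow : ∀ i, (((p^(j-i) - 1 : ℕ)):ℤ) = p^(j-i) - 1 := by
    intro i
    have : 1 ≤ p^(j-i) := Nat.one_le_pow _ _ hppos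
    push_cast [this]; ring
  have hsum : VEq v (∑ i ∈ Finset.range (j+1), (s i ^ p) ^ (p^(j-i) - 1) * S i) (-(E * W j)) := by
    rw [← Finset.add_sum_erase _ _ (Finset.mem_range.2 (by omega : i0 < j+1))]
    refine hv.eqadd (b := -(E * W j) + 1) ?_ ?_ (by omega)
    · refine (hv.eqmul (hv.eqpow d3 _) (hv.eqmul d4 hypv)).cast ?_
      rw [hppow, d2]; ring
    · refine hv.gesum _ _ _ fun i hi => ?_
      rw [Finset.mem_erase, Finset.mem_range] at hi
      rcases Nat.lt_or_ge i0 i with h | h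
      · obtain ⟨g1, g2⟩ := d5 i h (by omega)
        refine (hv.gemul (hv.gepow (hspge i (by omega)) _) (hv.gemul g2 hypv.ge)).mono ?_
        rw [hppow, g1]; linarith
      · have hlt : i < i0 := by omega
        refine (hv.gemul (hv.gepow (hspge i (by omega)) _) (hv.gemul (hdge i (by omega)) hypv.ge)).mono ?_
        rw [hppow]
        have g3 : (p:ℤ)^(i0-i) * W i < W i0 := by
          refine lt_of_le_of_ne (W_mono hW hlt.le (by omega)) ?_
          intro h
          apply d1
          rw [← h]
          exact Dvd.dvd.mul_right (dvd_pow_self _ (by omega)) _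
        have g4 : (p:ℤ)^(j-i) * W i < W j := by
          rw [d2]
          have : (p:ℤ)^(j-i) = p^(j-i0) * p^(i0-i) := by rw [← pow_add]; congr 1; omega
          rw [this, mul_assoc]
          exact mul_lt_mul_of_pos_left g3 (pow_pos (by omega) _)
        have g5 : (p:ℤ)^(j-i) * W i + 1 ≤ W j := g4
        have g6 := mul_le_mul_of_nonneg_left g5 hEpos.le
        nlinarith
  have hTj : VGe v (T j) (-(E * W j) + 1) :=
    (hv.gemul ((hsge j hjn).2 hj1) hypv.ge).mono (by linarith)
  have h7 := hv.eqadd hsum hTj (by omega)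
  have h8 := hv.eqmul hwv h7
  refine (hv.eqadd h8 (hv.gemul (hv.gepow hwv.ge 2) hQ) ?_).cast (by ring)
  push_cast; linarith

end core


section tower
variable {K L : Type*} [Field K] [Field L] [Algebra K L]
variable {p : ℕ} [hp : Fact p.Prime]

/-- Witt vectors whose first `n` coefficients lie in `S`. -/
def wsub (p : ℕ) [hp : Fact p.Prime] (S : Subring L) (n : ℕ) : Subring (WittVector p L) :=
  (((WittVector.truncate (p := p) (R := L) n).comp (WittVector.map S.subtype)).range).comap
    (WittVector.truncate n)

theorem mem_wsub {S : Subring L} {n : ℕ} {P : WittVector p L} :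
    P ∈ wsub p S n ↔ ∀ j < n, P.coeff j ∈ S := by
  unfold wsub
  rw [Subring.mem_comap, RingHom.mem_range]
  constructor
  · rintro ⟨Q, hQ⟩ j hj
    rw [RingHom.comp_apply] at hQ
    have := ww_trunc_eq.1 hQ j hj
    rw [← this, WittVector.map_coeff]; exact (Q.coeff j).2
  · intro h
    refine ⟨WittVector.mk p (fun j => if hj : j < n then ⟨P.coeff j, h j hj⟩ else 0), ?_⟩
    rw [RingHom.comp_apply]
    refine ww_trunc_eq.2 fun j hj => ?_
    rw [WittVector.map_coeff]; simp [hj]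

theorem vIter_coeff_lt (z : WittVector p L) (i : ℕ) {j : ℕ} (hj : j < i) :
    ((⇑WittVector.verschiebung)^[i] z).coeff j = 0 := by
  induction i generalizing j with
  | zero => omega
  | succ i ih =>
    rw [Function.iterate_succ_apply']
    cases j with
    | zero => exact WittVector.verschiebung_coeff_zero _
    | succ j => rw [WittVector.verschiebung_coeff_succ]; exact ih (by omega)

theorem vIter_coeff_ge (z : WittVector p L) (i : ℕ) {j : ℕ} (hj : i ≤ j) :
    ((⇑WittVector.verschiebung)^[i] z).coeff j = z.coeff (j - i) := by
  have := WittVector.iterate_verschiebung_coeff z i (j - i)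
  rwa [Nat.sub_add_cancel hj] at this

theorem vIter_mem {S : Subring L} {n : ℕ} {P : WittVector p L} (i : ℕ) (hP : P ∈ wsub p S n) :
    (⇑WittVector.verschiebung)^[i] P ∈ wsub p S n := by
  rw [mem_wsub] at *
  intro j hj
  rcases Nat.lt_or_ge j i with h | h
  · rw [vIter_coeff_lt _ _ h]; exact zero_mem _
  · rw [vIter_coeff_ge _ _ h]; exact hP _ (by omega)

/-- state in the tower construction -/
structure TState (p : ℕ) (K L : Type*) [Field K] [Field L] [Algebra K L] where
  M : IntermediateField K L
  E : ℤ
  z : WittVector p L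
  h : WittVector p L

/-- validity of the state at level `i` -/
structure TValid (v : L → WithTop ℤ) (n : ℕ) (x : WittVector p L) (U b : ℕ → ℤ) (i : ℕ)
    (st : TState p K L) : Prop where
  mp : MP v st.M p st.E
  hM : st.h ∈ wsub p st.M.toSubfield.toSubring n
  hx : x = st.h + (⇑WittVector.verschiebung)^[i] st.z
  az : ∀ j < n - i, (WittVector.frobenius st.z - st.z).coeff j ∈ st.M
  hc : ∀ j < n - i, (¬ (p:ℤ) ∣ (b i + p^i * (U (i+j) - U i)) ∧
      VEq v ((WittVector.frobenius st.z - st.z).coeff j) (-(st.E * (b i + p^i * (U (i+j) - U i))))) ∨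
      (∃ l, j = l + 1 ∧ (b i + p^i * (U (i+j) - U i)) = p * (b i + p^i * (U (i+l) - U i)) ∧
        VGe v ((WittVector.frobenius st.z - st.z).coeff j) (-(st.E * (b i + p^i * (U (i+j) - U i))) + 1))

theorem exists_seq_step {σ : Type*} (P : ℕ → σ → Prop) (R : ℕ → σ → σ → Prop) (s0 : σ) (h0 : P 0 s0)
    (hs : ∀ i s, P i s → ∃ s', P (i+1) s' ∧ R i s s') :
    ∃ f : ℕ → σ, f 0 = s0 ∧ ∀ i, P i (f i) ∧ R i (f i) (f (i+1)) := by
  choose g hg using hs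
  let F : (i : ℕ) → {s // P i s} := fun i => Nat.rec (motive := fun i => {s // P i s}) ⟨s0, h0⟩
    (fun i s => ⟨g i s.1 s.2, (hg i s.1 s.2).1⟩) i
  refine ⟨fun i => (F i).1, rfl, fun i => ⟨(F i).2, ?_⟩⟩
  exact (hg i (F i).1 (F i).2).2

theorem tower_step [CharP L p] {v : L → WithTop ℤ} (hv : VV v) {n : ℕ} {x : WittVector p L} {U b : ℕ → ℤ}
    (hUm : ∀ j, p * U j ≤ U (j+1)) (hU0 : 0 < U 0) (hb : ∀ d, b (d+1) = b d + p^(d+1) * (U (d+1) - U d))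
    (hbU : ∀ d, 0 < b d ∧ b d ≤ p ^ d * U d) (hbp : ∀ d, ¬ (p:ℤ) ∣ b d)
    {i : ℕ} (hi : i < n) {st : TState p K L} (H : TValid v n x U b i st) :
    ∃ st' : TState p K L, TValid v n x U b (i+1) st' ∧
      ASL v st.M p st.E st'.E (b i) (st.z.coeff 0) ∧ st'.M = stepF st.M (st.z.coeff 0) := by
  set y := st.z.coeff 0 with hy
  set a := (WittVector.frobenius st.z - st.z) with ha
  have h2 : (2:ℤ) ≤ p := by exact_mod_cast hp.out.two_le
  have hpp : Prime (p:ℤ) := Nat.prime_iff_prime_int.1 hp.out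
  have ha0 : a.coeff 0 = y ^ p - y := by
    rw [← WittVector.constantCoeff_apply, ha, map_sub, WittVector.constantCoeff_apply,
      WittVector.constantCoeff_apply, WittVector.coeff_frobenius_charP]
  have hEpos := H.mp.pos
  have ha0v : VEq v (y^p - y) (-(st.E * b i)) := by
    rw [← ha0]
    rcases H.hc 0 (by omega) with h | ⟨l, h, _⟩
    · simpa using h.2
    · omega
  have hbpos := (hbU i).1
  -- valuation of y
  have hy0 : y ≠ 0 := by
    intro h
    rw [h, zero_pow hp.out.ne_zero, sub_zero] at ha0v
    exact hv.ne ha0v rfl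
  obtain ⟨c, hc⟩ := hv.ex hy0
  have hEb : 0 < st.E * b i := mul_pos hEpos hbpos
  have hc0 : c < 0 := by
    by_contra hcc
    push Not at hcc
    have : VGe v (y^p - y) 0 :=
      hv.gesub ((hv.eqpow hc p).ge' (mul_nonneg (by omega) hcc)) (hc.ge' hcc)
    have := ha0v.le this
    omega
  have hpc : (p:ℤ) * c = -(st.E * b i) :=
    (hv.eqsub (hv.eqpow hc p) hc.ge (by nlinarith)).unique ha0v
  have hpE : (p:ℤ) ∣ st.E := by
    have : (p:ℤ) ∣ st.E * b i := ⟨-c, by linarith⟩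
    exact (hpp.dvd_or_dvd this).resolve_right (hbp i)
  obtain ⟨E', hE'⟩ := hpE
  have hyv : VEq v y (-(E' * b i)) := by
    refine hc.cast (mul_left_cancel₀ hpp.ne_zero ?_)
    rw [hpc, hE']; ring
  have HA : ASL v st.M p st.E E' (b i) y :=
    ⟨hv, hp.out, hbp i, hbpos, H.mp, hE', hyv, by rw [← ha0]; exact H.az 0 (by omega)⟩
  have hUi : ∀ l, 0 < U l := by
    intro l
    induction l with
    | zero => exact hU0
    | succ l ih => have := hUm l; nlinarith
  obtain ⟨s, hsM, hs0, hs⟩ := HA.core (fun j => a.coeff j) (fun j => b i + p^i * (U (i+j) - U i)) (n - i)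
    H.az ha0 (by simp) (by
      intro j _
      have h3 := hUm (i+j)
      have h4 := (hbU i).2
      have h5 : (0:ℤ) ≤ p^i := by positivity
      have h6 := mul_le_mul_of_nonneg_left h3 h5
      have : i + (j+1) = i + j + 1 := by ring
      rw [this]
      have h7 : 0 ≤ (p-1) * ((p:ℤ)^i * U i - b i) := mul_nonneg (by omega) (by linarith)
      nlinarith) H.hc
  set sv := WittVector.mk p s with hsv
  set z' := (st.z - sv).shift 1 with hz'
  have hzV : st.z - sv = WittVector.verschiebung z' := by
    refine WittVector.eq_iterate_verschiebung (n := 1) ?_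
    intro l hl
    have : l = 0 := by omega
    subst this
    rw [← WittVector.constantCoeff_apply, map_sub, WittVector.constantCoeff_apply,
      WittVector.constantCoeff_apply]
    change y - s 0 = 0
    rw [hs0, sub_self]
  have hFs : WittVector.mk p (fun i => s i ^ p) = WittVector.frobenius sv := by
    ext j; rw [WittVector.coeff_frobenius_charP]; rfl
  have hmka : WittVector.mk p (fun j => a.coeff j) = a := rfl
  have hexpr : WittVector.mk p (fun j => a.coeff j) - WittVector.mk p (fun i => s i ^ p) + WittVector.mk p s
      = WittVector.verschiebung (WittVector.frobenius z' - z') := by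
    rw [hmka, hFs, map_sub, WittVector.verschiebung_frobenius_comm z', ← hzV, map_sub, ha]
    ring
  rw [hexpr] at hs
  have hMle := le_stepF st.M y
  have hsvm : ∀ m, sv ∈ wsub p (stepF st.M y).toSubfield.toSubring m := fun m =>
    mem_wsub.2 fun j _ => hsM j
  have h7 : ∀ j, b (i+1) + p^(i+1) * (U (i+1+j) - U (i+1)) =
      p * (b i + p^i * (U (i+(j+1)) - U i)) - (p-1) * b i := by
    intro j
    have : i + (j+1) = i+1+j := by ring
    rw [hb, this]; ring
  refine ⟨⟨stepF st.M y, E', z', st.h + (⇑WittVector.verschiebung)^[i] sv⟩, ⟨?_, ?_, ?_, ?_, ?_⟩, HA, rfl⟩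
  · exact H.mp.step hv hp.out (hbp i) hE' hyv HA.hyM
  · refine add_mem ?_ (vIter_mem i (hsvm n))
    exact mem_wsub.2 fun j hj => hMle (mem_wsub.1 H.hM j hj)
  · change x = st.h + _ + _
    rw [H.hx, add_assoc]
    congr 1
    rw [Function.iterate_succ_apply, ← hzV, ← iterate_map_add]
    congr 1; ring
  · intro j hj
    change (WittVector.frobenius z' - z').coeff j ∈ stepF st.M y
    rw [← WittVector.verschiebung_coeff_succ, ← hexpr]
    refine (mem_wsub (S := (stepF st.M y).toSubfield.toSubring) (n := n - i)).1 ?_ (j+1) (by omega)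
    refine add_mem (sub_mem ?_ ?_) (hsvm _)
    · exact mem_wsub.2 fun j hj => hMle (H.az j hj)
    · exact mem_wsub.2 fun j hj => pow_mem (hsM j) p
  · intro j hj
    left
    have h3 := hs (j+1) (by omega) (by omega)
    change VEq v ((WittVector.verschiebung (WittVector.frobenius z' - z')).coeff (Nat.succ j)) _ at h3
    rw [WittVector.verschiebung_coeff_succ] at h3
    constructor
    · rw [h7]
      intro hd
      have h4 : (p:ℤ) ∣ (p-1) * b i := (dvd_sub_right (dvd_mul_right _ _)).1 hd
      rcases hpp.dvd_or_dvd h4 with h5 | h5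
      · have : (p:ℤ) ∣ 1 := (dvd_sub_right (dvd_refl _)).1 h5
        exact hpp.not_isUnit (isUnit_of_dvd_one this)
      · exact hbp i h5
    · refine h3.cast ?_
      change _ = -(E' * _)
      rw [h7, hE']; ring

theorem tower [CharP L p] {v : L → WithTop ℤ} (hv : VV v) {n : ℕ} {x : WittVector p L} {U b : ℕ → ℤ}
    (hUm : ∀ j, p * U j ≤ U (j+1)) (hU0 : 0 < U 0) (hb0 : b 0 = U 0)
    (hb : ∀ d, b (d+1) = b d + p^(d+1) * (U (d+1) - U d)) (hU0p : ¬ (p:ℤ) ∣ U 0)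
    {e : ℤ} (hmp : MP v (⊥ : IntermediateField K L) p e)
    (az : ∀ j < n, (WittVector.frobenius x - x).coeff j ∈ (⊥ : IntermediateField K L))
    (hc : ∀ j < n, (¬ (p:ℤ) ∣ U j ∧
      VEq v ((WittVector.frobenius x - x).coeff j) (-(e * U j))) ∨
      (∃ l, j = l + 1 ∧ U j = p * U l ∧
        VGe v ((WittVector.frobenius x - x).coeff j) (-(e * U j) + 1))) :
    ∃ (M : ℕ → IntermediateField K L) (E : ℕ → ℤ) (y : ℕ → L), M 0 = ⊥ ∧ E 0 = e ∧ y 0 = x.coeff 0 ∧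
      (∀ i < n, ASL v (M i) p (E i) (E (i+1)) (b i) (y i) ∧ M (i+1) = stepF (M i) (y i)) ∧
      MP v (M n) p (E n) ∧ (∀ j < n, x.coeff j ∈ M n) := by
  have h2 : (2:ℤ) ≤ p := by exact_mod_cast hp.out.two_le
  have hUi : ∀ l, 0 < U l := by
    intro l
    induction l with
    | zero => exact hU0
    | succ l ih => have := hUm l; nlinarith
  have hbU : ∀ d, 0 < b d ∧ b d ≤ p ^ d * U d := by
    intro d
    induction d with
    | zero => rw [hb0]; simpa using hU0
    | succ d ih =>
      rw [hb]
      have h3 := hUm d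
      have h4 := hUi d
      have h5 : (0:ℤ) < p^d := pow_pos (by omega) d
      have h6 : 0 ≤ (p:ℤ)^(d+1) * (U (d+1) - U d) := mul_nonneg (by positivity) (by nlinarith)
      refine ⟨by linarith, ?_⟩
      have h7 : (p:ℤ)^d * U d ≤ p^(d+1) * U d := by
        rw [pow_succ]; nlinarith [mul_pos h5 h4]
      linarith
  have hbp : ∀ d, ¬ (p:ℤ) ∣ b d := by
    intro d
    induction d with
    | zero => rwa [hb0]
    | succ d ih =>
      rw [hb]
      intro h
      exact ih ((dvd_add_left (Dvd.dvd.mul_right (dvd_pow_self _ (by omega)) _)).1 h)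
  obtain ⟨f, hf0, hf⟩ := exists_seq_step (σ := TState p K L)
    (fun i st => i ≤ n → TValid v n x U b i st)
    (fun i st st' => i < n → ASL v st.M p st.E st'.E (b i) (st.z.coeff 0) ∧ st'.M = stepF st.M (st.z.coeff 0))
    ⟨⊥, e, x, 0⟩
    (fun _ => ⟨hmp, zero_mem _, by simp, by simpa using az, by simpa [hb0] using hc⟩)
    (by
      intro i st hst
      by_cases hi : i < n
      · obtain ⟨st', h1, h3⟩ := tower_step hv hUm hU0 hb hbU hbp hi (hst hi.le)
        exact ⟨st', fun _ => h1, fun _ => h3⟩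
      · exact ⟨st, fun h => by omega, fun h => absurd h hi⟩)
  refine ⟨fun i => (f i).M, fun i => (f i).E, fun i => (f i).z.coeff 0, by simp [hf0], by simp [hf0],
    by simp [hf0], fun i hi => (hf i).2 hi, ((hf n).1 le_rfl).mp, ?_⟩
  have H := (hf n).1 le_rfl
  have h3 : x ∈ wsub p (f n).M.toSubfield.toSubring n := by
    rw [H.hx]
    refine add_mem H.hM (mem_wsub.2 fun j hj => ?_)
    rw [vIter_coeff_lt _ _ hj]; exact zero_mem _
  exact fun j hj => mem_wsub.1 h3 j hj

end tower


section ramshift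
variable {K L : Type*} [Field K] [Field L] [Algebra K L]
variable {p : ℕ} [hp : Fact p.Prime]

/-- tower data -/
structure TD (v : L → WithTop ℤ) (p n : ℕ) (M : ℕ → IntermediateField K L) (E : ℕ → ℤ) (y : ℕ → L)
    (b : ℕ → ℤ) : Prop where
  hv : VV v
  M0 : M 0 = ⊥
  asl : ∀ i < n, ASL v (M i) p (E i) (E (i+1)) (b i) (y i)
  Ms : ∀ i < n, M (i+1) = stepF (M i) (y i)
  top : M n = ⊤
  bm : ∀ i, b i < b (i+1)
  En : E n = 1

theorem ASL.shift [CharP L p] {v : L → WithTop ℤ} {M : IntermediateField K L}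
    {E E' b : ℤ} {y : L} (H : ASL v M p E E' b y) (σ : L ≃ₐ[K] L) {C : ℤ} (hC : 0 < C)
    (hy : VEq v (σ y - y) (-(E' * b) + C))
    (hM : ∀ z ∈ M, ∀ a, VEq v z a → VGe v (σ z - z) (a + C + 1)) :
    ∀ z ∈ stepF M y, ∀ a, VEq v z a → VGe v (σ z - z) (a + C) ∧
      (¬ E ∣ a → VEq v (σ z - z) (a + C)) := by
  have hv := H.hv
  intro z hz a ha
  obtain ⟨c, hc, rfl⟩ := stepF_expand H.hp.two_le M H.hyM hz
  have hσy : VEq v (σ y) (-(E' * b)) := by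
    have : σ y = y + (σ y - y) := by ring
    rw [this]; exact hv.eqadd H.hy hy.ge (by omega)
  have hsub : σ (∑ i ∈ Finset.range p, c i * y ^ i) - ∑ i ∈ Finset.range p, c i * y ^ i =
      ∑ i ∈ Finset.range p, ((σ (c i) - c i) * (σ y) ^ i + c i * ((y + (σ y - y)) ^ i - y ^ i)) := by
    rw [map_sum, ← Finset.sum_sub_distrib]
    refine Finset.sum_congr rfl fun i _ => ?_
    rw [map_mul, map_pow, add_sub_cancel]; ring
  -- bound for each term
  have hterm : ∀ i, ∀ a, VEq v (c i * y ^ i) a →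
      VGe v ((σ (c i) - c i) * (σ y) ^ i) (a + C + 1) ∧
      VGe v (c i * ((y + (σ y - y)) ^ i - y ^ i)) (a + C) ∧
      (¬ p ∣ i → VEq v (c i * ((y + (σ y - y)) ^ i - y ^ i)) (a + C)) := by
    intro i a hi
    obtain ⟨k, hk1, hk2⟩ := term_val hv H.hM H.hE H.hy (hc i) i hi
    have hak : a = E * k + i * (-(E' * b)) := by rw [hk2, H.hE]; ring
    have hpd := hv.powdiff (p := p) H.hy hC hy i
    refine ⟨(hv.gemul (hM _ (hc i) _ hk1) (hv.eqpow hσy i).ge).mono (by rw [hak]; linarith),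
      (hv.gemul hk1.ge hpd.1).mono (by rw [hak]; linarith), fun h => ?_⟩
    exact (hv.eqmul hk1 (hpd.2 h)).cast (by rw [hak]; ring)
  have hterm' : ∀ i a, VGe v (c i * y ^ i) a →
      VGe v ((σ (c i) - c i) * (σ y) ^ i + c i * ((y + (σ y - y)) ^ i - y ^ i)) (a + C) := by
    intro i a hi
    by_cases h0 : c i * y ^ i = 0
    · have hc0 : c i = 0 := (mul_eq_zero.1 h0).resolve_right (pow_ne_zero _ (hv.ne H.hy))
      rw [hc0]; simpa using hv.zero _
    · obtain ⟨a', ha'⟩ := hv.ex h0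
      have := ha'.le hi
      obtain ⟨h1, h2, _⟩ := hterm i a' ha'
      exact hv.geadd (h1.mono (by omega)) (h2.mono (by omega))
  rcases terms_distinct hv H.hp H.hb H.hM H.hE H.hy hc with h | ⟨i, hi, a', h1, h2, h3⟩
  · exact absurd (Finset.sum_eq_zero h) (hv.ne ha)
  have haa := h2.unique ha
  subst haa
  rw [hsub]
  constructor
  · refine hv.gesum _ _ _ fun j hj => hterm' j _ ?_
    by_cases hji : j = i
    · rw [hji]; exact h1.ge
    · exact (h3 j hj hji).mono (by omega)
  · intro hEa
    rw [← Finset.add_sum_erase _ _ hi]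
    refine hv.eqadd (b := a' + 1 + C) ?_ (hv.gesum _ _ _ fun j hj => ?_) (by omega)
    · obtain ⟨g1, g2, g3⟩ := hterm i a' h1
      refine hv.eqadd' g1 (g3 ?_) (by omega)
      intro hpi
      have hi0 : i = 0 := Nat.eq_zero_of_dvd_of_lt hpi (Finset.mem_range.1 hi)
      subst hi0
      obtain ⟨k, hk1, hk2⟩ := term_val hv H.hM H.hE H.hy (hc 0) 0 h1
      apply hEa
      refine ⟨k, ?_⟩
      rw [hk2, H.hE]; push_cast; ring
    · rw [Finset.mem_erase] at hj
      exact hterm' j _ (h3 j hj.2 hj.1)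

variable {v : L → WithTop ℤ} {n : ℕ} {M : ℕ → IntermediateField K L} {E : ℕ → ℤ} {y : ℕ → L} {b : ℕ → ℤ}

theorem TD.bpos (T : TD v p n M E y b) (hn : 1 ≤ n) (i : ℕ) : 0 < b i := by
  induction i with
  | zero => exact (T.asl 0 (by omega)).bpos
  | succ i ih => have := T.bm i; omega

theorem TD.bmono (T : TD v p n M E y b) : StrictMono b := strictMono_nat_of_lt_succ T.bm

theorem TD.chain [CharP L p] (T : TD v p n M E y b) (hn : 1 ≤ n) (σ : L ≃ₐ[K] L) {j : ℕ}
    (hj : j < n) (hfix : ∀ z ∈ M j, σ z = z) (hne : σ (y j) ≠ y j) (m : ℕ) (hm : j ≤ m) (hmn : m < n) :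
    VEq v (σ (y m) - y m) (-(E (m+1) * b m) + E (m+1) * b j) ∧
    ∀ z ∈ M m, ∀ a, VEq v z a → VGe v (σ z - z) (a + E (m+1) * b j + 1) := by
  have hv := T.hv
  have h2 : (2:ℤ) ≤ p := by exact_mod_cast hp.out.two_le
  have hpp : Prime (p:ℤ) := Nat.prime_iff_prime_int.1 hp.out
  have hbj := T.bpos hn j
  induction m, hm using Nat.le_induction with
  | base =>
    constructor
    · set c := σ (y j) - y j with hc
      have hcp : c ^ p = c := by
        have h3 := hfix _ (T.asl j hj).hyM
        rw [map_sub, map_pow] at h3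
        have h4 : c ^ p = σ (y j) ^ p - y j ^ p := map_sub (frobenius L p) _ _
        rw [h4, hc]; linear_combination h3
      exact (hv.frobfix hp.out.two_le hcp (sub_ne_zero.2 hne)).cast (by ring)
    · intro z hz a _
      rw [hfix z hz, sub_self]; exact hv.zero _
  | succ m hm ih =>
    obtain ⟨i1, i2⟩ := ih (by omega)
    have A := T.asl m (by omega)
    have A' := T.asl (m+1) hmn
    have hE1 := A.E'pos
    have hE2 := A'.E'pos
    have hsh := A.shift σ (mul_pos hE1 hbj) i1 i2
    rw [← T.Ms m (by omega)] at hsh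
    have hlt : b j < b (m+1) := T.bmono (by omega)
    constructor
    · set f := y (m+1) ^ p - y (m+1) with hf
      have hfv : VEq v f (-(E (m+1) * b (m+1))) := A'.a0val
      have h3 := (hsh f A'.hyM _ hfv).2 (by
        rw [dvd_neg, A.hE, mul_comm (p:ℤ)]
        intro h
        exact A'.hb ((mul_dvd_mul_iff_left hE1.ne').1 h))
      set c := σ (y (m+1)) - y (m+1) with hc
      have hcf : c ^ p - c = σ f - f := by
        have h4 : c ^ p = σ (y (m+1)) ^ p - y (m+1) ^ p := map_sub (frobenius L p) _ _
        rw [h4, hc, hf, map_sub, map_pow]; ring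
      rw [← hcf] at h3
      have hneg : -(E (m+1) * b (m+1)) + E (m+1) * b j < 0 := by nlinarith
      have hc0 : c ≠ 0 := by
        intro h
        rw [h, zero_pow hp.out.ne_zero, sub_zero] at h3
        exact hv.ne h3 rfl
      obtain ⟨d, hd⟩ := hv.ex hc0
      have hd0 : d < 0 := by
        by_contra hcc
        push Not at hcc
        have : VGe v (c^p - c) 0 :=
          hv.gesub ((hv.eqpow hd p).ge' (mul_nonneg (by omega) hcc)) (hd.ge' hcc)
        have := h3.le this
        omega
      have hpd := (hv.eqsub (hv.eqpow hd p) hd.ge (by nlinarith)).unique h3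
      refine hd.cast (mul_left_cancel₀ hpp.ne_zero ?_)
      rw [hpd, A'.hE]; ring
    · intro z hz a ha
      refine (hsh z hz a ha).1.mono ?_
      have : E (m+1) * b j = p * (E (m+1+1) * b j) := by rw [A'.hE]; ring
      have h5 : 0 < E (m+1+1) * b j := mul_pos hE2 hbj
      nlinarith

theorem TD.ramval [CharP L p] (T : TD v p n M E y b) (hn : 1 ≤ n) (σ : L ≃ₐ[K] L) {j : ℕ}
    (hj : j < n) (hfix : ∀ z ∈ M j, σ z = z) (hne : σ (y j) ≠ y j) {π : L} (hπ : VEq v π 1) :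
    VEq v (σ π - π) (1 + b j) ∧ InInertia v σ := by
  have hv := T.hv
  have hbj := T.bpos hn j
  obtain ⟨m, rfl⟩ : ∃ m, n = m + 1 := ⟨n - 1, by omega⟩
  obtain ⟨i1, i2⟩ := T.chain hn σ hj hfix hne m (by omega) (by omega)
  have A := T.asl m (by omega)
  have hE1 : E (m+1) = 1 := T.En
  have hsh := A.shift σ (mul_pos A.E'pos hbj) i1 i2
  rw [← T.Ms m (by omega), T.top, hE1, one_mul] at hsh
  constructor
  · refine (hsh π (IntermediateField.mem_top) 1 hπ).2 ?_
    rw [A.hE, hE1, mul_one]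
    intro h
    exact (Nat.prime_iff_prime_int.1 hp.out).not_isUnit (isUnit_of_dvd_one h)
  · intro z hz
    by_cases hz0 : z = 0
    · rw [hz0, map_zero, sub_self]; exact hv.zero 1
    · obtain ⟨a, ha⟩ := hv.ex hz0
      have h3 : 0 ≤ a := ha.le hz
      exact (hsh z (IntermediateField.mem_top) a ha).1.mono (by omega)

theorem TD.exj (T : TD v p n M E y b) (σ : L ≃ₐ[K] L) {d : ℕ} (hd : d ≤ n)
    (h : ¬ ∀ z ∈ M d, σ z = z) : ∃ j < d, (∀ z ∈ M j, σ z = z) ∧ σ (y j) ≠ y j := by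
  induction d with
  | zero =>
    exfalso; apply h
    intro z hz
    rw [T.M0, IntermediateField.mem_bot] at hz
    obtain ⟨r, rfl⟩ := hz
    exact σ.commutes r
  | succ d ih =>
    by_cases h1 : ∀ z ∈ M d, σ z = z
    · refine ⟨d, by omega, h1, ?_⟩
      intro h2
      apply h
      intro z hz
      rw [T.Ms d (by omega)] at hz
      have A := T.asl d (by omega)
      obtain ⟨c, hc, rfl⟩ := stepF_expand A.hp.two_le (M d) A.hyM hz
      rw [map_sum]
      refine Finset.sum_congr rfl fun i _ => ?_
      rw [map_mul, map_pow, h2, h1 _ (hc i)]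
    · obtain ⟨j, hj, hj'⟩ := ih (by omega) h1
      exact ⟨j, by omega, hj'⟩

theorem TD.ramGrp_eq [CharP L p] (T : TD v p n M E y b) (hn : 1 ≤ n) {π : L} (hπ : VEq v π 1)
    {t : ℝ} {d : ℕ} (hd : d ≤ n) (h1 : ∀ i < d, (b i : ℝ) < t) (h2 : d < n → t ≤ b d) :
    ramGrp K v π t = ((M d).fixingSubgroup : Set (L ≃ₐ[K] L)) := by
  have hv := T.hv
  ext σ
  have hceil : ∀ j : ℕ, (⌈t + 1⌉ ≤ 1 + b j ↔ t ≤ b j) := by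
    intro j
    rw [Int.ceil_le]; push_cast
    constructor <;> intro h <;> linarith
  rw [SetLike.mem_coe, IntermediateField.mem_fixingSubgroup_iff]
  constructor
  · intro hσ
    by_contra hcon
    obtain ⟨j, hj, hf, hne⟩ := T.exj σ hd hcon
    obtain ⟨g1, g2⟩ := T.ramval hn σ (by omega) hf hne hπ
    have h3 : ⌈t+1⌉ ≤ 1 + b j := g1.le hσ.2
    have := (hceil j).1 h3
    have := h1 j hj
    linarith
  · intro hσ
    by_cases htop : ∀ z ∈ M n, σ z = z
    · rw [T.top] at htop
      have : ∀ z, σ z = z := fun z => htop z IntermediateField.mem_top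
      refine ⟨fun z _ => ?_, ?_⟩
      · rw [this, sub_self]; exact hv.zero 1
      · rw [this, sub_self]; exact hv.zero _
    · obtain ⟨j, hj, hf, hne⟩ := T.exj σ le_rfl htop
      have hdj : d ≤ j := by
        by_contra hcon
        push Not at hcon
        apply hne
        apply hσ
        have hmono : ∀ i, j + 1 ≤ i → i ≤ d → M (j+1) ≤ M i := by
          intro i hi
          induction i, hi using Nat.le_induction with
          | base => intro _; exact le_rfl
          | succ i hi ih =>
            intro hid
            refine (ih (by omega)).trans ?_
            rw [T.Ms i (by omega)]; exact le_stepF _ _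
        refine hmono d hcon le_rfl ?_
        rw [T.Ms j hj]; exact mem_stepF _ _
      obtain ⟨g1, g2⟩ := T.ramval hn σ hj hf hne hπ
      refine ⟨g2, ?_⟩
      refine g1.ge' ((hceil j).2 ?_)
      have h3 := h2 (by omega)
      have h4 : (b d : ℝ) ≤ b j := by exact_mod_cast T.bmono.monotone hdj
      linarith

theorem TD.finrank [FiniteDimensional K L] (T : TD v p n M E y b) {d : ℕ} (hd : d ≤ n) :
    Module.finrank K (M d) = p ^ d := by
  induction d with
  | zero => rw [T.M0]; simp
  | succ d ih =>
    have A := T.asl d (by omega)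
    rw [T.Ms d (by omega), stepF_finrank T.hv A.hp A.hb A.hM A.hE A.hy A.hyM, ih (by omega), pow_succ]
    ring

theorem TD.ncard [CharP L p] [FiniteDimensional K L] [IsGalois K L] (T : TD v p n M E y b) (hn : 1 ≤ n)
    {π : L} (hπ : VEq v π 1)
    {t : ℝ} {d : ℕ} (hd : d ≤ n) (h1 : ∀ i < d, (b i : ℝ) < t) (h2 : d < n → t ≤ b d) :
    (ramGrp K v π t).ncard = p ^ (n - d) := by
  rw [T.ramGrp_eq hn hπ hd h1 h2]
  have h3 : ((M d).fixingSubgroup : Set (L ≃ₐ[K] L)).ncard = Nat.card (M d).fixingSubgroup :=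
    Nat.card_coe_set_eq _
  rw [h3, IsGalois.card_fixingSubgroup_eq_finrank]
  have h4 := Module.finrank_mul_finrank K (M d) L
  have h5 : Module.finrank K L = p ^ n := by
    rw [← T.finrank le_rfl, T.top, IntermediateField.finrank_top']
  rw [T.finrank hd, h5] at h4
  have h6 : p ^ n = p ^ d * p ^ (n-d) := by rw [← pow_add]; congr 1; omega
  rw [h6] at h4
  exact Nat.eq_of_mul_eq_mul_left (pow_pos hp.out.pos d) h4

end ramshift


section herbrand
variable {K L : Type*} [Field K] [Field L] [Algebra K L]
variable {p : ℕ} [hp : Fact p.Prime]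
variable {v : L → WithTop ℤ} {n : ℕ} {M : ℕ → IntermediateField K L} {E : ℕ → ℤ} {y : ℕ → L} {b : ℕ → ℤ}

theorem exd (b : ℕ → ℤ) (n : ℕ) (t : ℝ) : ∃ d ≤ n, (∀ i < d, (b i : ℝ) < t) ∧ (d < n → t ≤ b d) := by
  have h : ∃ d, d = n ∨ t ≤ b d := ⟨n, Or.inl rfl⟩
  refine ⟨Nat.find h, Nat.find_min' h (Or.inl rfl), ?_, ?_⟩
  · intro i hi
    have := Nat.find_min h hi
    push Not at this
    exact this.2
  · intro hd
    rcases Nat.find_spec h with h1 | h1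
    · omega
    · exact h1

theorem ramGrp_anti (v : L → WithTop ℤ) (π : L) {s t : ℝ} (hst : s ≤ t) :
    ramGrp K v π t ⊆ ramGrp K v π s := by
  rintro σ ⟨h1, h2⟩
  refine ⟨h1, le_trans ?_ h2⟩
  exact_mod_cast Int.ceil_le_ceil (by linarith)

theorem TD.breaks [CharP L p] [FiniteDimensional K L] [IsGalois K L] (T : TD v p n M E y b) (hn : 1 ≤ n)
    {π : L} (hπ : VEq v π 1) {U : ℕ → ℤ} (hb0 : b 0 = U 0)
    (hb : ∀ d, b (d+1) = b d + p^(d+1) * (U (d+1) - U d)) (u : ℝ) :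
    IsUpperBreak K v π u ↔ ∃ i < n, u = U i := by
  have hp0 : (0:ℝ) < p := by exact_mod_cast hp.out.pos
  set f : ℝ → ℝ := fun t => ((ramGrp K v π t).ncard : ℝ) / ((ramGrp K v π 0).ncard : ℝ) with hf
  have hbpos : ∀ i, (0:ℝ) < b i := fun i => by exact_mod_cast T.bpos hn i
  have hbm : StrictMono (fun i => (b i : ℝ)) := fun i j hij => by
    change (b i : ℝ) < b j
    exact_mod_cast T.bmono hij
  have hn0 : (ramGrp K v π 0).ncard = p ^ n := by
    have := T.ncard hn hπ (t := 0) (d := 0) (by omega) (by simp) (fun _ => (hbpos 0).le)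
    simpa using this
  have hval : ∀ t (d : ℕ), d ≤ n → (∀ i < d, (b i : ℝ) < t) → (d < n → t ≤ b d) → f t = ((p:ℝ)^d)⁻¹ := by
    intro t d h1 h2 h3
    simp only [hf]
    rw [T.ncard hn hπ h1 h2 h3, hn0]
    push_cast
    have : (p:ℝ)^n = p^(n-d) * p^d := by rw [← pow_add]; congr 1; omega
    rw [this]; field_simp
  have hlow : ∀ t, ((p:ℝ)^n)⁻¹ ≤ f t := by
    intro t
    obtain ⟨d, h1, h2, h3⟩ := exd b n t
    rw [hval t d h1 h2 h3]
    have : (p:ℝ)^d ≤ p^n := pow_le_pow_right₀ (by exact_mod_cast hp.out.one_le) h1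
    exact inv_anti₀ (by positivity) this
  have hanti : Antitone f := by
    intro s t hst
    simp only [hf]
    have : (ramGrp K v π t).ncard ≤ (ramGrp K v π s).ncard :=
      Set.ncard_le_ncard (ramGrp_anti v π hst) (Set.toFinite _)
    gcongr
  have hIntg : ∀ a c, IntervalIntegrable f MeasureTheory.volume a c := fun a c => hanti.intervalIntegrable
  have hφ : ∀ x, hhPhi K v π x = ∫ t in (0:ℝ)..x, f t := fun x => rfl
  have hdiff : ∀ x z, hhPhi K v π z - hhPhi K v π x = ∫ t in x..z, f t := by
    intro x z
    rw [hφ, hφ, intervalIntegral.integral_interval_sub_left (hIntg _ _) (hIntg _ _)]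
  have hq : (0:ℝ) < ((p:ℝ)^n)⁻¹ := by positivity
  have hlb : ∀ x z, x ≤ z → ((p:ℝ)^n)⁻¹ * (z - x) ≤ hhPhi K v π z - hhPhi K v π x := by
    intro x z hxz
    rw [hdiff]
    have := intervalIntegral.integral_mono_on hxz (intervalIntegrable_const (c := ((p:ℝ)^n)⁻¹)) (hIntg x z)
      (fun t _ => hlow t)
    rw [intervalIntegral.integral_const, smul_eq_mul] at this
    linarith
  have hsm : StrictMono (hhPhi K v π) := by
    intro x z hxz
    have h1 := hlb x z hxz.le
    have h2 : 0 < ((p:ℝ)^n)⁻¹ * (z - x) := mul_pos hq (by linarith)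
    linarith
  have hcont : Continuous (hhPhi K v π) := intervalIntegral.continuous_primitive hIntg 0
  have hφ0 : hhPhi K v π 0 = 0 := by rw [hφ]; simp
  have hsurj : ∀ w, 0 ≤ w → ∃ t ∈ Set.Ici (0:ℝ), hhPhi K v π t = w := by
    intro w hw
    have hN : 0 ≤ w * (p:ℝ)^n := by positivity
    have h1 := hlb 0 (w * (p:ℝ)^n) hN
    rw [hφ0, sub_zero, sub_zero, mul_comm w, inv_mul_cancel_left₀ (by positivity)] at h1
    have h2 := intermediate_value_Icc (mul_comm w _ ▸ hN) hcont.continuousOn (a := 0) (b := (p:ℝ)^n * w)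
    obtain ⟨t, ht, ht'⟩ := h2 (show w ∈ Set.Icc _ _ from ⟨by rw [hφ0]; exact hw, h1⟩)
    exact ⟨t, ht.1, ht'⟩
  have hψ : ∀ w, 0 ≤ w → 0 ≤ hhPsi K v π w ∧ hhPhi K v π (hhPsi K v π w) = w := by
    intro w hw
    exact ⟨Function.invFunOn_mem (hsurj w hw), Function.invFunOn_eq (hsurj w hw)⟩
  have hψφ : ∀ t, 0 ≤ t → hhPsi K v π (hhPhi K v π t) = t := by
    intro t ht
    have : 0 ≤ hhPhi K v π t := by rw [← hφ0]; exact hsm.monotone ht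
    exact hsm.injective (hψ _ this).2
  have hφb : ∀ i < n, hhPhi K v π (b i) = U i := by
    intro i
    induction i with
    | zero =>
      intro h0
      rw [hφ]
      have : ∫ t in (0:ℝ)..(b 0), f t = ∫ t in (0:ℝ)..(b 0), (1:ℝ) := by
        apply intervalIntegral.integral_congr_ae
        refine Filter.Eventually.of_forall fun t ht => ?_
        rw [Set.uIoc_of_le (hbpos 0).le] at ht
        rw [hval t 0 (by omega) (by simp) (fun _ => ht.2)]; simp
      rw [this]; simp [hb0]
    | succ i ih =>
      intro hi
      have h1 := hdiff (b i) (b (i+1))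
      have hle : (b i : ℝ) ≤ b (i+1) := (hbm (Nat.lt_succ_self i)).le
      have : ∫ t in (b i : ℝ)..(b (i+1)), f t = ∫ t in (b i : ℝ)..(b (i+1)), ((p:ℝ)^(i+1))⁻¹ := by
        apply intervalIntegral.integral_congr_ae
        refine Filter.Eventually.of_forall fun t ht => ?_
        rw [Set.uIoc_of_le hle] at ht
        refine hval t (i+1) (by omega) (fun j hj => ?_) (fun _ => ht.2)
        exact lt_of_le_of_lt (hbm.monotone (by omega : j ≤ i)) ht.1
      rw [this, intervalIntegral.integral_const, ih (by omega), smul_eq_mul] at h1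
      have h2 : (b (i+1) : ℝ) - b i = p^(i+1) * (U (i+1) - U i) := by
        rw [hb]; push_cast; ring
      rw [h2] at h1
      have h3 : (p:ℝ)^(i+1) ≠ 0 := by positivity
      field_simp at h1
      linarith
  constructor
  · rintro ⟨hu, hne⟩
    obtain ⟨ht0, htu⟩ := hψ u hu
    set t := hhPsi K v π u with ht
    obtain ⟨d, h1, h2, h3⟩ := exd b n t
    rcases Nat.lt_or_ge d n with hdn | hdn
    · refine ⟨d, hdn, ?_⟩
      rcases (h3 hdn).eq_or_lt with h4 | h4
      · rw [← htu, h4, hφb d hdn]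
      · exfalso
        have hε : 0 < hhPhi K v π (b d) - u := by
          have := hsm h4; linarith
        apply hne _ hε
        unfold upperRamGrp
        rw [add_sub_cancel, hψφ _ (hbpos d).le, ← ht, T.ramGrp_eq hn hπ h1 h2 h3]
        exact T.ramGrp_eq hn hπ h1 (fun i hi => (h2 i hi).trans h4) (fun _ => le_rfl)
    · exfalso
      apply hne 1 one_pos
      unfold upperRamGrp
      rw [← ht, T.ramGrp_eq hn hπ h1 h2 h3]
      obtain ⟨g0, g1⟩ := hψ (u+1) (by linarith)
      have h4 : t < hhPsi K v π (u+1) := by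
        rw [← hsm.lt_iff_lt, g1, htu]; linarith
      exact T.ramGrp_eq hn hπ h1 (fun i hi => (h2 i hi).trans h4) (fun h => by omega)
  · rintro ⟨i, hi, rfl⟩
    have hU : (0:ℝ) ≤ U i := by
      rw [← hφb i hi, ← hφ0]; exact hsm.monotone (hbpos i).le
    refine ⟨hU, ?_⟩
    intro ε hε heq
    unfold upperRamGrp at heq
    have e1 : hhPsi K v π (U i) = b i := by rw [← hφb i hi, hψφ _ (hbpos i).le]
    obtain ⟨g0, g1⟩ := hψ (U i + ε) (by linarith)
    have h4 : (b i : ℝ) < hhPsi K v π (U i + ε) := by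
      rw [← hsm.lt_iff_lt, g1, hφb i hi]; linarith
    obtain ⟨d, h1, h2, h3⟩ := exd b n (hhPsi K v π (U i + ε))
    have hid : i < d := by
      by_contra hcon
      push Not at hcon
      have h5 := h3 (by omega)
      have h6 : (b d : ℝ) ≤ b i := hbm.monotone hcon
      linarith
    have c1 := T.ncard hn hπ h1 h2 h3
    have c2 := T.ncard hn hπ (t := b i) (d := i) hi.le (fun j hj => hbm hj) (fun _ => le_rfl)
    rw [heq, e1, c2] at c1
    have := Nat.pow_right_injective hp.out.two_le c1
    omega

end herbrand


section galois
variable {p : ℕ} [hp : Fact p.Prime]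

theorem prime_field {L : Type*} [Field L] [CharP L p] {c : L} (h : c ^ p = c) : ∃ N : ℕ, c = N := by
  have h1 : c ∈ (ZMod.castHom dvd_rfl L : ZMod p →+* L).fieldRange := by
    have := (Subfield.mem_bot_iff_pow_eq_self L p (x := c)).2 h
    exact (bot_le : (⊥ : Subfield L) ≤ _) this
  obtain ⟨z, rfl⟩ := h1
  exact ⟨z.val, by rw [← map_natCast (ZMod.castHom dvd_rfl L : ZMod p →+* L), ZMod.natCast_zmod_val]⟩

theorem galois_diff {K L : Type*} [Field K] [Field L] [Algebra K L] [CharP L p] (n : ℕ)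
    (x : WittVector p L)
    (az : ∀ j < n, (WittVector.frobenius x - x).coeff j ∈ (⊥ : IntermediateField K L))
    (τ : L →ₐ[K] L) : ∀ j < n, ∃ N : ℕ,
      (WittVector.map (τ : L →+* L) x - x).coeff j = N := by
  set d := WittVector.map (τ : L →+* L) x - x with hd
  have h1 : WittVector.truncate n (WittVector.map (τ : L →+* L) (WittVector.frobenius x - x)) =
      WittVector.truncate n (WittVector.frobenius x - x) := by
    refine ww_trunc_eq.2 fun j hj => ?_
    rw [WittVector.map_coeff]
    obtain ⟨c, hc⟩ := IntermediateField.mem_bot.1 (az j hj)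
    rw [← hc]; exact τ.commutes c
  have h2 : WittVector.map (τ : L →+* L) (WittVector.frobenius x) =
      WittVector.frobenius (WittVector.map (τ : L →+* L) x) := by
    ext j; simp [WittVector.coeff_frobenius_charP]
  have h3 : WittVector.truncate n (WittVector.frobenius d) = WittVector.truncate n d := by
    rw [map_sub, map_sub, map_sub, h2] at h1
    rw [hd, map_sub, map_sub, map_sub]
    linear_combination h1
  intro j hj
  apply prime_field (p := p)
  have := ww_trunc_eq.1 h3 j hj
  rwa [WittVector.coeff_frobenius_charP] at this

theorem galois_mem {K L : Type*} [Field K] [Field L] [Algebra K L] [CharP L p] (n : ℕ)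
    (x : WittVector p L)
    (az : ∀ j < n, (WittVector.frobenius x - x).coeff j ∈ (⊥ : IntermediateField K L))
    (S : Subring L) (hS : ∀ j < n, x.coeff j ∈ S)
    (τ : L →ₐ[K] L) : ∀ j < n, τ (x.coeff j) ∈ S := by
  have h1 : WittVector.map (τ : L →+* L) x - x ∈ wsub p S n := mem_wsub.2 fun j hj => by
    obtain ⟨N, hN⟩ := galois_diff n x az τ j hj
    rw [hN]; exact natCast_mem S N
  have h2 := add_mem h1 (mem_wsub.2 hS : x ∈ wsub p S n)
  rw [sub_add_cancel] at h2
  exact mem_wsub.1 h2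

theorem galois_cyclic {K L : Type*} [Field K] [Field L] [Algebra K L] [CharP L p] {n : ℕ} (hn : 1 ≤ n)
    (x : WittVector p L)
    (az : ∀ j < n, (WittVector.frobenius x - x).coeff j ∈ (⊥ : IntermediateField K L))
    [FiniteDimensional K L] [IsGalois K L] (hf : Module.finrank K L = p ^ n)
    (hx0 : x.coeff 0 ∉ (⊥ : IntermediateField K L)) : IsCyclic (L ≃ₐ[K] L) := by
  obtain ⟨σ, hσ⟩ : ∃ σ : L ≃ₐ[K] L, σ (x.coeff 0) ≠ x.coeff 0 := by
    by_contra! h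
    exact hx0 (IntermediateField.mem_bot.2 (by
      have := (IsGalois.mem_range_algebraMap_iff_fixed (F := K) (x.coeff 0)).2 h
      simpa using this))
  have hcard : Nat.card (L ≃ₐ[K] L) = p ^ n := by rw [IsGalois.card_aut_eq_finrank, hf]
  have hone : σ ^ p ^ n = 1 := by rw [← hcard]; exact pow_card_eq_one'
  set d := WittVector.map ((σ : L →ₐ[K] L) : L →+* L) x - x with hd
  have hdj := galois_diff n x az (σ : L →ₐ[K] L)
  have hfix : ∀ N : ℕ, ∀ j < n, (WittVector.map (((σ ^ N : L ≃ₐ[K] L) : L →ₐ[K] L) : L →+* L) x).coeff j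
      = (x + (N : WittVector p L) * d).coeff j := by
    intro N
    induction N with
    | zero => intro j hj; simp
    | succ N ih =>
      have e1 : WittVector.map (((σ ^ (N+1) : L ≃ₐ[K] L) : L →ₐ[K] L) : L →+* L) x =
          WittVector.map ((σ : L →ₐ[K] L) : L →+* L)
            (WittVector.map (((σ ^ N : L ≃ₐ[K] L) : L →ₐ[K] L) : L →+* L) x) := by
        ext j; simp [pow_succ']
      have e2 : WittVector.truncate n (WittVector.map ((σ : L →ₐ[K] L) : L →+* L)
            (WittVector.map (((σ ^ N : L ≃ₐ[K] L) : L →ₐ[K] L) : L →+* L) x)) =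
          WittVector.truncate n (WittVector.map ((σ : L →ₐ[K] L) : L →+* L) (x + (N : WittVector p L) * d)) := by
        refine ww_trunc_eq.2 fun j hj => ?_
        rw [WittVector.map_coeff, ih j hj, WittVector.map_coeff]
      have e3 : WittVector.truncate n (WittVector.map ((σ : L →ₐ[K] L) : L →+* L) d) =
          WittVector.truncate n d := by
        refine ww_trunc_eq.2 fun j hj => ?_
        obtain ⟨N, hN⟩ := hdj j hj
        rw [WittVector.map_coeff, hN]; simp
      have e4 : WittVector.map ((σ : L →ₐ[K] L) : L →+* L) x = x + d := by rw [hd]; ring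
      refine ww_trunc_eq.1 ?_
      rw [e1, e2]
      simp only [map_add, map_mul, map_natCast, e3, e4]
      push_cast; ring
  have hne : ¬ σ ^ p ^ (n-1) = 1 := by
    intro h
    have h1 := hfix (p ^ (n-1))
    have h2 : WittVector.truncate n (((p:ℕ):WittVector p L) ^ (n-1) * d) = 0 := by
      have : WittVector.truncate n x = WittVector.truncate n (x + ((p ^ (n-1) : ℕ) : WittVector p L) * d) := by
        refine ww_trunc_eq.2 fun j hj => ?_
        rw [← h1 j hj, h]; simp
      rw [map_add] at this
      push_cast at this ⊢
      linear_combination -this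
    have h3 := ww_trunc_eq.1 (h2.trans (map_zero (WittVector.truncate n)).symm) (n-1) (by omega)
    have h4 : ((p:ℕ):WittVector p L) ^ (n-1) * d =
        (⇑WittVector.verschiebung)^[n-1] ((⇑WittVector.frobenius)^[n-1] d) := by
      rw [WittVector.iterate_verschiebung_iterate_frobenius, mul_comm]
    rw [h4, vIter_coeff_ge _ _ le_rfl, Nat.sub_self, WittVector.iterate_frobenius_coeff] at h3
    have h5 : d.coeff 0 = 0 := by
      rw [WittVector.zero_coeff] at h3
      exact eq_zero_of_pow_eq_zero h3
    apply hσ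
    have h6 : WittVector.constantCoeff d = WittVector.constantCoeff
      (WittVector.map ((σ : L →ₐ[K] L) : L →+* L) x) - WittVector.constantCoeff x := by
      rw [hd, map_sub]
    change d.coeff 0 = σ (x.coeff 0) - x.coeff 0 at h6
    rw [h5] at h6
    exact (sub_eq_zero.1 h6.symm)
  have ho : orderOf σ = p ^ n := by
    obtain ⟨k, rfl⟩ : ∃ k, n = k + 1 := ⟨n-1, by omega⟩
    exact orderOf_eq_prime_pow hne hone
  exact isCyclic_of_orderOf_eq_card σ (by rw [ho, hcard])
end galois


section base
variable {p : ℕ} [hp : Fact p.Prime]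

theorem lfVal_ne {K k : Type*} [Field K] [Field k] (ι : K ≃+* LaurentSeries k) {x : K} (hx : x ≠ 0) :
    lfVal ι x = (((ι x).order : ℤ) : WithTop ℤ) := by
  unfold lfVal lsVal
  rw [if_neg (by simpa using hx)]

theorem ext_trivial {K L : Type*} [Field K] [Field L] [Algebra K L] [Algebra.IsAlgebraic K L]
    {v : L → WithTop ℤ} (hv : VV v) (ht : ∀ c : K, c ≠ 0 → VEq v (algebraMap K L c) 0) {π : L}
    (hπ : VEq v π 1) : False := by
  have hπ0 := hv.ne hπ
  obtain ⟨f, hf0, hf⟩ := (Algebra.IsAlgebraic.isAlgebraic (R := K) π)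
  have hge : ∀ c : K, VGe v (algebraMap K L c) 0 := by
    intro c
    by_cases h : c = 0
    · rw [h, map_zero]; exact hv.zero 0
    · exact (ht c h).ge
  have key : ∀ (N : ℕ) (f : Polynomial K), f.natDegree ≤ N → f ≠ 0 → Polynomial.aeval π f ≠ 0 := by
    intro N
    induction N with
    | zero =>
      intro f hN hf
      rw [Polynomial.eq_C_of_natDegree_le_zero hN] at hf ⊢
      rw [Polynomial.aeval_C]
      intro h
      apply hf
      rw [(map_eq_zero _).1 h, map_zero]
    | succ N ih =>
      intro f hN hf h
      have e := Polynomial.X_mul_divX_add f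
      by_cases h0 : f.coeff 0 = 0
      · rw [h0, map_zero, add_zero] at e
        have h1 : f.divX ≠ 0 := by rintro h1; rw [h1, mul_zero] at e; exact hf e.symm
        apply ih f.divX (by rw [Polynomial.natDegree_divX_eq_natDegree_tsub_one]; omega) h1
        rw [← e, map_mul, Polynomial.aeval_X] at h
        exact (mul_eq_zero.1 h).resolve_left hπ0
      · rw [← e, map_add, map_mul, Polynomial.aeval_X, Polynomial.aeval_C] at h
        have hg : VGe v (Polynomial.aeval π f.divX) 0 := by
          rw [Polynomial.aeval_eq_sum_range]
          refine hv.gesum _ _ _ fun i _ => ?_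
          rw [Algebra.smul_def]
          exact (hv.gemul (hge _) (hv.gepow (hπ.ge' (b := 0) (by norm_num)) i)).mono (by simp)
        have h2 := hv.gemul hπ.ge hg
        rw [eq_neg_of_add_eq_zero_left h] at h2
        have := (hv.eqneg (ht _ h0)).le h2
        omega
  exact key _ f le_rfl hf0 hf

theorem mp_bot {K k L : Type*} [Field K] [Field k] [CharP k p] [PerfectField k] [Field L] [Algebra K L]
    [Algebra.IsAlgebraic K L] (ι : K ≃+* LaurentSeries k)
    {v : L → WithTop ℤ} (hv : VV v) {e : ℕ} (he : ExtendsWithE (lfVal ι) v e) {π : L}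
    (hπ : VEq v π 1) : MP v (⊥ : IntermediateField K L) p (e : ℤ) := by
  have hval : ∀ c : K, c ≠ 0 → VEq v (algebraMap K L c) (e * (ι c).order) := fun c hc =>
    he c _ (lfVal_ne ι hc)
  have hpos : 0 < (e:ℤ) := by
    rcases Nat.eq_zero_or_pos e with h | h
    · exfalso
      refine ext_trivial hv (fun c hc => (hval c hc).cast ?_) hπ
      rw [h]; simp
    · exact_mod_cast h
  refine ⟨hpos, ?_, ?_, ?_⟩
  · intro z hz hz0
    obtain ⟨c, rfl⟩ := IntermediateField.mem_bot.1 hz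
    have : c ≠ 0 := by rintro rfl; exact hz0 (map_zero _)
    exact ⟨_, hval c this⟩
  · refine ⟨algebraMap K L (ι.symm (HahnSeries.single 1 1)), IntermediateField.mem_bot.2 ⟨_, rfl⟩, ?_⟩
    refine (hval _ ?_).cast ?_
    · simp
    · rw [RingEquiv.apply_symm_apply, HahnSeries.order_single one_ne_zero, mul_one]
  · intro z hz hz0
    obtain ⟨c, rfl⟩ := IntermediateField.mem_bot.1 hz
    have hc : c ≠ 0 := by rintro rfl; exact hv.ne hz0 (map_zero _)
    have ho : (ι c).order = 0 := by
      have := hz0.unique (hval c hc)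
      rcases mul_eq_zero.1 this.symm with h | h
      · omega
      · exact h
    have : PerfectRing k p := PerfectField.toPerfectRing p
    obtain ⟨r, hr⟩ := surjective_frobenius k p ((ι c).coeff 0)
    rw [frobenius_def] at hr
    refine ⟨algebraMap K L (ι.symm (HahnSeries.C r)), IntermediateField.mem_bot.2 ⟨_, rfl⟩, ?_⟩
    rw [← map_pow, ← map_sub]
    by_cases h0 : c - ι.symm (HahnSeries.C r) ^ p = 0
    · rw [h0, map_zero]; exact hv.zero 1
    · refine (hval _ h0).ge' ?_
      have h1 : ι (c - ι.symm (HahnSeries.C r) ^ p) = ι c - HahnSeries.C ((ι c).coeff 0) := by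
        rw [map_sub, map_pow, RingEquiv.apply_symm_apply, ← map_pow, hr]
      have h2 : 0 < (ι (c - ι.symm (HahnSeries.C r) ^ p)).order := by
        have hne : ι (c - ι.symm (HahnSeries.C r) ^ p) ≠ 0 := (map_ne_zero_iff ι ι.injective).2 h0
        have hge : 0 ≤ (ι (c - ι.symm (HahnSeries.C r) ^ p)).order := by
          by_contra! hlt
          have h3 := HahnSeries.coeff_order_eq_zero.not.2 hne
          apply h3
          set w := (ι (c - ι.symm (HahnSeries.C r) ^ p)).order
          rw [h1, HahnSeries.coeff_sub, HahnSeries.coeff_eq_zero_of_lt_order (by rw [ho]; exact hlt),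
            HahnSeries.C_apply, HahnSeries.coeff_single_of_ne hlt.ne, sub_zero]
        refine lt_of_le_of_ne hge fun h => ?_
        have h3 := HahnSeries.coeff_order_eq_zero.not.2 hne
        apply h3
        rw [← h, h1, HahnSeries.coeff_sub]
        simp
      nlinarith
end base


section breaksU
variable {p : ℕ} [hp : Fact p.Prime]

/-- the upper breaks -/
def uB (p : ℕ) (m : ℕ → ℤ) : ℕ → ℤ
  | 0 => m 0
  | (j+1) => max (p * uB p m j) (m (j+1))

/-- the lower breaks -/
def lB (p : ℕ) (m : ℕ → ℤ) : ℕ → ℤ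
  | 0 => m 0
  | (j+1) => lB p m j + p ^ (j+1) * (uB p m (j+1) - uB p m j)

theorem uB_pos {m : ℕ → ℤ} (h : 0 < m 0) (j : ℕ) : 0 < uB p m j := by
  have hp0 : 0 < (p:ℤ) := by exact_mod_cast hp.out.pos
  induction j with
  | zero => exact h
  | succ j ih => exact lt_of_lt_of_le (mul_pos hp0 ih) (le_max_left _ _)

theorem uB_lt {m : ℕ → ℤ} (h : 0 < m 0) (j : ℕ) : uB p m j < uB p m (j+1) := by
  have hp2 : 2 ≤ (p:ℤ) := by exact_mod_cast hp.out.two_le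
  have h1 := uB_pos (p := p) h j
  refine lt_of_lt_of_le ?_ (le_max_left _ _)
  nlinarith

theorem lB_lt {m : ℕ → ℤ} (h : 0 < m 0) (j : ℕ) : lB p m j < lB p m (j+1) := by
  have hp0 : 0 < (p:ℤ) := by exact_mod_cast hp.out.pos
  have h1 := uB_lt (p := p) h j
  have : 0 < (p:ℤ) ^ (j+1) * (uB p m (j+1) - uB p m j) := mul_pos (pow_pos hp0 _) (by linarith)
  change _ < lB p m j + _
  linarith

theorem uB_ge (m : ℕ → ℤ) (d : ℕ) : ∀ j ≤ d, (p:ℤ) ^ (d - j) * m j ≤ uB p m d := by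
  have hp0 : 0 ≤ (p:ℤ) := by positivity
  induction d with
  | zero => intro j hj; obtain rfl : j = 0 := by omega
            simp [uB]
  | succ d ih =>
    intro j hj
    rcases Nat.lt_or_ge d j with h | h
    · obtain rfl : j = d + 1 := by omega
      rw [Nat.sub_self, pow_zero, one_mul]; exact le_max_right _ _
    · refine le_trans ?_ (le_max_left _ _)
      rw [show d + 1 - j = (d - j) + 1 by omega, pow_succ', mul_assoc]
      exact mul_le_mul_of_nonneg_left (ih j h) hp0

theorem uB_ex (m : ℕ → ℤ) (d : ℕ) : ∃ j ≤ d, uB p m d = (p:ℤ) ^ (d - j) * m j := by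
  induction d with
  | zero => exact ⟨0, le_rfl, by simp [uB]⟩
  | succ d ih =>
    obtain ⟨j, hj, h⟩ := ih
    rcases max_choice (p * uB p m d) (m (d+1)) with h1 | h1
    · refine ⟨j, by omega, ?_⟩
      change max _ _ = _
      rw [h1, h, show d + 1 - j = (d - j) + 1 by omega, pow_succ', mul_assoc]
    · refine ⟨d+1, le_rfl, ?_⟩
      change max _ _ = _
      rw [h1, Nat.sub_self, pow_zero, one_mul]

theorem uB_sup (m : ℕ → ℤ) (d : ℕ) (h : (Finset.range (d+1)).Nonempty) :
    (uB p m d : ℝ) = (Finset.range (d+1)).sup' h (fun j => (p:ℝ) ^ (d + 1 - 1 - j) * (m j : ℝ)) := by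
  apply le_antisymm
  · obtain ⟨j, hj, e⟩ := uB_ex (p := p) m d
    rw [e]
    refine le_trans (le_of_eq ?_) (Finset.le_sup' _ (Finset.mem_range.2 (by omega : j < d + 1)))
    push_cast; rfl
  · refine Finset.sup'_le _ _ fun j hj => ?_
    have := uB_ge (p := p) m d j (by have := Finset.mem_range.1 hj; omega)
    rw [Nat.add_sub_cancel]
    exact_mod_cast this

theorem uB_hc {L : Type*} [Field L] {v : L → WithTop ℤ} (hv : VV v) {m : ℕ → ℤ} (h : 0 < m 0)
    {e : ℤ} (he : 0 < e) {n : ℕ} {α : ℕ → L} (h0 : ∀ j < n, α j = 0 → m j = 0)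
    (h1 : ∀ j < n, α j ≠ 0 → VEq v (α j) (-(e * m j)))
    (h2 : ∀ j < n, 0 < m j → ¬ (p:ℤ) ∣ m j) :
    ∀ j < n, (¬(p:ℤ) ∣ uB p m j ∧ VEq v (α j) (-(e * uB p m j))) ∨
      (∃ l, j = l + 1 ∧ uB p m j = p * uB p m l ∧ VGe v (α j) (-(e * uB p m j) + 1)) := by
  intro j hj
  by_cases hm : uB p m j = m j
  · left
    have hpos := uB_pos (p := p) h j
    rw [hm] at hpos ⊢
    exact ⟨h2 j hj hpos, h1 j hj (fun hh => by rw [h0 j hj hh] at hpos; exact lt_irrefl _ hpos)⟩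
  · right
    cases j with
    | zero => exact absurd rfl hm
    | succ l =>
      have e1 : uB p m (l+1) = max (p * uB p m l) (m (l+1)) := rfl
      have e2 : uB p m (l+1) = p * uB p m l := by
        rcases max_choice (p * uB p m l) (m (l+1)) with h3 | h3
        · rw [e1, h3]
        · exact absurd (e1.trans h3) hm
      refine ⟨l, rfl, e2, ?_⟩
      have hlt : m (l+1) < uB p m (l+1) := lt_of_le_of_ne (by rw [e1]; exact le_max_right _ _) (Ne.symm hm)
      by_cases hz : α (l+1) = 0
      · rw [hz]; exact hv.zero _
      · refine (h1 _ hj hz).ge' ?_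
        nlinarith
end breaksU


section final
variable {p : ℕ} [hp : Fact p.Prime]

theorem lift_witt {K Ω : Type*} [Field K] [Field Ω] [Algebra K Ω] [CharP Ω p] {n : ℕ}
    (a : TruncatedWittVector p n K) (x : TruncatedWittVector p n Ω)
    (hx : wittF x = x + wittMap (algebraMap K Ω) a) (X : WittVector p Ω)
    (hX : ∀ j (hj : j < n), X.coeff j = x.coeff ⟨j, hj⟩) :
    ∀ j (hj : j < n), (WittVector.frobenius X - X).coeff j = algebraMap K Ω (a.coeff ⟨j, hj⟩) := by
  have h1 : WittVector.truncate n X = x := by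
    ext i; rw [WittVector.coeff_truncate, hX i i.2]
  have h2 : WittVector.truncate n (WittVector.frobenius X) = wittF x := by
    ext i; rw [WittVector.coeff_truncate, WittVector.coeff_frobenius_charP, hX i i.2]
    simp [wittF]
  have h3 : WittVector.truncate n (WittVector.frobenius X - X) = wittMap (algebraMap K Ω) a := by
    rw [map_sub, h1, h2, hx]; ring
  intro j hj
  have h4 := congrArg (fun z => TruncatedWittVector.coeff (⟨j, hj⟩ : Fin n) z) h3
  simpa [WittVector.coeff_truncate, wittMap, -map_sub] using h4

theorem main_gen {k : Type} [Field k] [PerfectField k] [CharP k p]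
    {K : Type} [Field K] [CharP K p] (ι : K ≃+* LaurentSeries k)
    {n : ℕ} (hn : 1 ≤ n) (a : TruncatedWittVector p n K)
    (hred : ∀ i : Fin n, 0 ≤ lfVal ι (a.coeff i) ∨
      ∀ z : ℤ, lfVal ι (a.coeff i) = (z : WithTop ℤ) → ¬ (p : ℤ) ∣ z)
    (m : ℕ → ℤ) (hm : ∀ i : Fin n, m (i : ℕ) = -(ι (a.coeff i)).order)
    (hm0 : 0 < m 0) {L : Type} [Field L] [Algebra K L] [CharP L p] [FiniteDimensional K L] [IsGalois K L]
    (X : WittVector p L)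
    (hX : ∀ j (hj : j < n), (WittVector.frobenius X - X).coeff j = algebraMap K L (a.coeff ⟨j, hj⟩))
    (htop : ∀ M : IntermediateField K L, (∀ j < n, X.coeff j ∈ M) → M = ⊤)
    (v : L → WithTop ℤ) (hv : IsNormVal v) (e : ℕ) (he : ExtendsWithE (lfVal ι) v e)
    (π : L) (hπ : v π = (1 : ℤ)) :
    IsCyclic (L ≃ₐ[K] L) ∧ Module.finrank K L = p ^ n ∧ e = p ^ n ∧
    (∀ u' : ℝ, IsUpperBreak K v π u' ↔ ∃ i < n, u' = uB p m i) := by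
  have hV : VV v := ⟨hv.1, hv.2.1, hv.2.2.1⟩
  have hπ' : VEq v π 1 := hπ
  have hmp : MP v (⊥ : IntermediateField K L) p (e : ℤ) := mp_bot ι hV he hπ'
  have az : ∀ j < n, (WittVector.frobenius X - X).coeff j ∈ (⊥ : IntermediateField K L) := by
    intro j hj
    rw [hX j hj]; exact IntermediateField.mem_bot.2 ⟨_, rfl⟩
  have h2 : ∀ j < n, 0 < m j → ¬ (p:ℤ) ∣ m j := by
    intro j hj hpos
    have hne : a.coeff ⟨j, hj⟩ ≠ 0 := by
      intro h0
      have := hm ⟨j, hj⟩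
      rw [h0] at this; simp at this; omega
    have h3 := hred ⟨j, hj⟩
    rw [lfVal_ne ι hne] at h3
    have h4 := hm ⟨j, hj⟩
    simp only at h4
    rcases h3 with h3 | h3
    · have : 0 ≤ (ι (a.coeff ⟨j, hj⟩)).order := by exact_mod_cast h3
      omega
    · rw [h4, Int.dvd_neg]; exact h3 _ rfl
  have hc := uB_hc (p := p) hV hm0 hmp.pos (n := n) (α := fun j => (WittVector.frobenius X - X).coeff j)
    (by
      intro j hj h0
      rw [hX j hj] at h0
      have h0 := (map_eq_zero _).1 h0
      have := hm ⟨j, hj⟩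
      rw [h0] at this; simpa using this)
    (by
      intro j hj h0
      rw [hX j hj] at h0 ⊢
      have h0 : a.coeff ⟨j, hj⟩ ≠ 0 := fun h => h0 (by rw [h, map_zero])
      have h5 : VEq v _ _ := he _ _ (lfVal_ne ι h0)
      refine h5.cast ?_
      have := hm ⟨j, hj⟩
      simp only at this
      rw [this]; ring) h2
  obtain ⟨M, E, y, hM0, hE0, hy0, hasl, hMP, hmem⟩ := tower (p := p) hV (n := n) (x := X)
    (U := uB p m) (b := lB p m) (fun j => le_max_left _ _) hm0 rfl (fun d => rfl) (h2 0 (by omega) hm0) hmp az hc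
  have hMn : M n = ⊤ := htop _ hmem
  have hEn : E n = 1 := by
    obtain ⟨k, hk⟩ := hMP.vals π (by rw [hMn]; trivial) (hV.ne hπ')
    have h3 := hπ'.unique hk
    exact Int.eq_one_of_dvd_one hMP.pos.le ⟨k, h3⟩
  have T : TD v p n M E y (lB p m) := ⟨hV, hM0, fun i hi => (hasl i hi).1, fun i hi => (hasl i hi).2, hMn,
    fun i => lB_lt hm0 i, hEn⟩
  have hfin : Module.finrank K L = p ^ n := by
    have h3 := T.finrank le_rfl
    rw [hMn] at h3
    rw [← h3]; exact IntermediateField.finrank_top'.symm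
  have hEe : ∀ d ≤ n, (e:ℤ) = p ^ d * E d := by
    intro d
    induction d with
    | zero => intro _; rw [hE0]; simp
    | succ d ih =>
      intro hd
      rw [ih (by omega), (hasl d (by omega)).1.hE, pow_succ]; ring
  have hx0 : X.coeff 0 ∉ (⊥ : IntermediateField K L) := by
    intro h
    have h3 := (hasl 0 (by omega)).1
    rw [hM0, hE0, hy0] at h3
    obtain ⟨k, hk⟩ := h3.hM.vals _ h (h3.hv.ne h3.hy)
    have h4 := h3.hy.unique hk
    rw [h3.hE] at h4
    apply h3.hb
    refine ⟨-k, ?_⟩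
    have h5 := h3.E'pos.ne'
    apply mul_left_cancel₀ h5
    linear_combination -h4
  refine ⟨galois_cyclic hn X az hfin hx0, hfin, ?_, ?_⟩
  · have := hEe n le_rfl
    rw [hEn, mul_one] at this
    exact_mod_cast this
  · exact fun u => T.breaks (U := uB p m) hn hπ' rfl (fun d => rfl) u
end final

/-- Theorem 7 of the paper, the main theorem.  Let `K ≅ k((t))` be a
local field of characteristic `p > 0` with perfect residue field `k` and let
`a = (a_0, …, a_{n-1}) ∈ W_n(K)` be a reduced Witt vector.  For `0 ≤ i ≤ n-1` set
`m_i = -v_K(a_i)`, and assume `m_0 > 0`.  Let `x ∈ W_n(K^sep)` satisfy `F(x) = x ⊕ a`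
and set `K_n = K(x_0, …, x_{n-1})`.  Then `K_n/K` is a totally ramified
`(ℤ/p^nℤ)`-extension (Galois, cyclic, of degree `p^n`, with ramification index
`e = p^n`), and its upper ramification breaks are exactly the numbers
`u_i = max{p^{i-1}m_0, p^{i-2}m_1, …, p m_{i-2}, m_{i-1}}` for `1 ≤ i ≤ n`.
Here `v, π` are the normalized valuation and a uniformizer of `K_n`. -/
theorem stmt_6 {p : ℕ} [Fact p.Prime] (k : Type) [Field k] [PerfectField k] [CharP k p]
    (K : Type) [Field K] [CharP K p] (ι : K ≃+* LaurentSeries k)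
    (n : ℕ) (hn : 1 ≤ n) (a : TruncatedWittVector p n K)
    (hred : ∀ i : Fin n, 0 ≤ lfVal ι (a.coeff i) ∨
      ∀ z : ℤ, lfVal ι (a.coeff i) = (z : WithTop ℤ) → ¬ (p : ℤ) ∣ z)
    (m : ℕ → ℤ) (hm : ∀ i : Fin n, m (i : ℕ) = -(ι (a.coeff i)).order)
    (hm0 : 0 < m 0)
    (x : TruncatedWittVector p n (SepCl K))
    (hx : wittF x = x + wittMap (algebraMap K (SepCl K)) a)
    (Kn : IntermediateField K (SepCl K))
    (hKn : Kn = IntermediateField.adjoin K {α : SepCl K | ∃ j : Fin n, x.coeff j = α})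
    (v : Kn → WithTop ℤ) (hv : IsNormVal v) (e : ℕ) (he : ExtendsWithE (lfVal ι) v e)
    (π : Kn) (hπ : v π = (1 : ℤ)) :
    IsGalois K Kn ∧
    IsCyclic (Kn ≃ₐ[K] Kn) ∧
    Module.finrank K Kn = p ^ n ∧
    e = p ^ n ∧
    (∀ u' : ℝ, IsUpperBreak K v π u' ↔
      ∃ i, ∃ hi : i ∈ Finset.Icc 1 n,
        u' = (Finset.range i).sup'
          (Finset.nonempty_range_iff.mpr (by have := (Finset.mem_Icc.mp hi).1; omega))
          (fun j => (p : ℝ) ^ (i - 1 - j) * (m j : ℝ))) := by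
  have : CharP (SepCl K) p := charP_of_injective_algebraMap (algebraMap K (SepCl K)).injective p
  have : CharP Kn p := charP_of_injective_algebraMap (algebraMap K Kn).injective p
  have hxm : ∀ j : Fin n, x.coeff j ∈ Kn := by
    intro j; rw [hKn]; exact IntermediateField.subset_adjoin _ _ ⟨j, rfl⟩
  set X : WittVector p (SepCl K) := WittVector.mk p (fun j => if h : j < n then x.coeff ⟨j, h⟩ else 0) with hXdef
  have hXc : ∀ j (hj : j < n), X.coeff j = x.coeff ⟨j, hj⟩ := by
    intro j hj; simp [hXdef, hj]
  have hXa := lift_witt a x hx X hXc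
  set Y : WittVector p Kn := WittVector.mk p (fun j => if h : j < n then ⟨x.coeff ⟨j, h⟩, hxm _⟩ else 0) with hYdef
  have hYc : ∀ j (hj : j < n), Y.coeff j = ⟨x.coeff ⟨j, hj⟩, hxm _⟩ := by
    intro j hj; simp [hYdef, hj]
  have hYX : WittVector.map (algebraMap Kn (SepCl K)) Y = X := by
    ext j
    rw [WittVector.map_coeff]
    by_cases h : j < n
    · rw [hYc j h, hXc j h]; rfl
    · simp [hYdef, hXdef, h]
  have hYa : ∀ j (hj : j < n), (WittVector.frobenius Y - Y).coeff j = algebraMap K Kn (a.coeff ⟨j, hj⟩) := by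
    intro j hj
    apply (algebraMap Kn (SepCl K)).injective
    rw [← WittVector.map_coeff, map_sub, hYX, ← IsScalarTower.algebraMap_apply, ← hXa j hj]
    congr 2
    ext i
    rw [WittVector.map_coeff, WittVector.coeff_frobenius_charP, WittVector.coeff_frobenius_charP, map_pow,
      ← WittVector.map_coeff, hYX]
  have hIntg : ∀ z : SepCl K, IsIntegral K z := fun z => Algebra.IsIntegral.isIntegral z
  have hfd : FiniteDimensional K Kn := by
    rw [hKn]
    exact IntermediateField.finiteDimensional_adjoin (S := Set.range fun j : Fin n => x.coeff j)
      (fun z _ => hIntg z)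
  have hnorm : Normal K Kn := by
    rw [IntermediateField.normal_iff_forall_map_le]
    intro τ
    rw [IntermediateField.map_le_iff_le_comap]
    conv_lhs => rw [hKn]
    rw [IntermediateField.adjoin_le_iff]
    rintro _ ⟨j, rfl⟩
    have h1 := galois_mem n X (fun j hj => by
      rw [hXa j hj]; exact IntermediateField.mem_bot.2 ⟨_, rfl⟩) Kn.toSubring
      (fun j hj => by rw [hXc j hj]; exact hxm _) τ j j.2
    rw [hXc j j.2] at h1
    exact h1
  have hgal : IsGalois K Kn := ⟨⟩
  have htop : ∀ M : IntermediateField K Kn, (∀ j < n, Y.coeff j ∈ M) → M = ⊤ := by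
    intro M hM
    rw [eq_top_iff]
    rintro z -
    have h1 : Kn ≤ IntermediateField.lift M := by
      conv_lhs => rw [hKn]
      rw [IntermediateField.adjoin_le_iff]
      rintro _ ⟨j, rfl⟩
      have := hM j j.2
      rw [hYc j j.2] at this
      exact (IntermediateField.mem_lift (⟨x.coeff j, hxm j⟩ : Kn)).2 this
    exact (IntermediateField.mem_lift z).1 (h1 z.2)
  obtain ⟨h1, h2, h3, h4⟩ := main_gen ι hn a hred m hm hm0 Y hYa htop v hv e he π hπ
  refine ⟨hgal, h1, h2, h3, fun u' => (h4 u').trans ?_⟩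
  constructor
  · rintro ⟨i, hi, rfl⟩
    exact ⟨i + 1, Finset.mem_Icc.2 ⟨by omega, by omega⟩, uB_sup m i _⟩
  · rintro ⟨i, hi, rfl⟩
    have hi' := Finset.mem_Icc.1 hi
    obtain ⟨d, rfl⟩ : ∃ d, i = d + 1 := ⟨i - 1, by omega⟩
    exact ⟨d, by omega, (uB_sup m d _).symm⟩
end
end
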